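/- Let P be a PAG over a finite node set V that is adjustment amenable relative to disjoint nonempty node sets (X,Y), and let Z ⊆ V be disjoint from X ∪ Y with Z ∩ Forb(X,Y,P) = ∅. Then every proper definite status non-causal path from X to Y in P is blocked by Z (condition (2) of the GAC) if and only if for every MAG M ∈ [P], every proper non-causal path from X to Y in M is blocked by Z (condition (b) of the AC). -/

import Mathlib

open scoped Classical

/-- Edge marks: tail, arrowhead, circle. -/
inductive Mark : Type
  | tail
  | arrow
  | circle
  deriving DecidableEq

/-- A partial mixed graph over a node set `V`: any two distinct nodes are joined by
at most one edge; `mark a b` is the mark at `b` on the edge between `a` and `b`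
(`none` if there is no edge). -/
structure PMG (V : Type) where
  mark : V → V → Option Mark
  symm : ∀ a b, (mark a b).isSome ↔ (mark b a).isSome
  irrefl : ∀ a, mark a a = none

namespace PMG

variable {V : Type}

/-- `a` and `b` are adjacent. -/
def Adj (G : PMG V) (a b : V) : Prop := (G.mark a b).isSome

/-- directed edge `a → b`. -/
def DirEdge (G : PMG V) (a b : V) : Prop :=
  G.mark a b = some Mark.arrow ∧ G.mark b a = some Mark.tail

/-- bidirected edge `a ↔ b`. -/
def BidirEdge (G : PMG V) (a b : V) : Prop :=
  G.mark a b = some Mark.arrow ∧ G.mark b a = some Mark.arrow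

/-- non-directed edge `a o-o b`. -/
def NondirEdge (G : PMG V) (a b : V) : Prop :=
  G.mark a b = some Mark.circle ∧ G.mark b a = some Mark.circle

/-- A path: a nonempty list of distinct nodes in which successive nodes are adjacent. -/
def IsPath (G : PMG V) (p : List V) : Prop :=
  p ≠ [] ∧ p.Nodup ∧ p.Chain' G.Adj

/-- A path from `a` to `b` (with at least one edge). -/
def IsPathFromTo (G : PMG V) (p : List V) (a b : V) : Prop :=
  IsPath G p ∧ p.head? = some a ∧ p.getLast? = some b ∧ 2 ≤ p.length

/-- All edges on `p` are directed towards the end of `p`. -/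
def DirectedAlong (G : PMG V) (p : List V) : Prop :=
  ∀ i a b, p[i]? = some a → p[i+1]? = some b → G.DirEdge a b

/-- No edge on `p` has an arrowhead at its endpoint closer to the start of `p`
(`p` is possibly directed). -/
def PossDirAlong (G : PMG V) (p : List V) : Prop :=
  ∀ i a b, p[i]? = some a → p[i+1]? = some b → G.mark b a ≠ some Mark.arrow

/-- `b` is a descendant of `a`: a directed path (possibly of length 0) from `a` to `b`. -/
def Descendant (G : PMG V) (a b : V) : Prop :=
  ∃ p, IsPath G p ∧ DirectedAlong G p ∧ p.head? = some a ∧ p.getLast? = some b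

/-- `b` is a possible descendant of `a`. -/
def PossDescendant (G : PMG V) (a b : V) : Prop :=
  ∃ p, IsPath G p ∧ PossDirAlong G p ∧ p.head? = some a ∧ p.getLast? = some b

/-- The node at position `i+1` of `p` is a collider on `p`. -/
def ColliderAt (G : PMG V) (p : List V) (i : ℕ) : Prop :=
  ∃ a b c, p[i]? = some a ∧ p[i+1]? = some b ∧ p[i+2]? = some c ∧
    G.mark a b = some Mark.arrow ∧ G.mark c b = some Mark.arrow

/-- The node at position `i+1` of `p` is a definite non-collider on `p`. -/
def DefNonColliderAt (G : PMG V) (p : List V) (i : ℕ) : Prop :=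
  ∃ a b c, p[i]? = some a ∧ p[i+1]? = some b ∧ p[i+2]? = some c ∧
    (G.mark a b = some Mark.tail ∨ G.mark c b = some Mark.tail ∨
      (G.mark a b = some Mark.circle ∧ G.mark c b = some Mark.circle ∧ ¬ G.Adj a c))

/-- `p` is of definite status. -/
def DefStatus (G : PMG V) (p : List V) : Prop :=
  ∀ i, i + 2 < p.length → (ColliderAt G p i ∨ DefNonColliderAt G p i)

/-- `p` is a definite status path that is m-connecting given `Z`. -/
def MConn (G : PMG V) (Z : Finset V) (p : List V) : Prop :=
  DefStatus G p ∧
  (∀ i b, p[i+1]? = some b → DefNonColliderAt G p i → b ∉ Z) ∧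
  (∀ i b, p[i+1]? = some b → ColliderAt G p i → ∃ z ∈ Z, Descendant G b z)

/-- `a` and `b` are m-separated given `Z`: every definite status path between them
is blocked by `Z`. -/
def MSep (G : PMG V) (a b : V) (Z : Finset V) : Prop :=
  ∀ p, IsPathFromTo G p a b → ¬ MConn G Z p

/-- Two graphs have the same m-separation relations. -/
def MarkovEquiv (G H : PMG V) : Prop :=
  ∀ a b (Z : Finset V), a ≠ b → a ∉ Z → b ∉ Z → (MSep G a b Z ↔ MSep H a b Z)

/-- `G` is a DAG: all edges directed and no directed cycle. -/
def IsDAG (G : PMG V) : Prop :=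
  (∀ a b, G.Adj a b → G.DirEdge a b ∨ G.DirEdge b a) ∧
  (∀ a b, Descendant G a b → Descendant G b a → a = b)

/-- A mixed graph: edges only `→` or `↔`. -/
def IsMixed (G : PMG V) : Prop :=
  ∀ a b, G.Adj a b → G.DirEdge a b ∨ G.DirEdge b a ∨ G.BidirEdge a b

/-- Ancestral mixed graph: no directed cycle, no almost directed cycle. -/
def IsAncestral (G : PMG V) : Prop :=
  IsMixed G ∧ (∀ a b, Descendant G a b → Descendant G b a → a = b) ∧
  (∀ a b, Descendant G a b → ¬ G.BidirEdge b a)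

/-- Maximal ancestral graph. -/
def IsMAG (G : PMG V) : Prop :=
  IsAncestral G ∧ ∀ a b : V, a ≠ b → ¬ G.Adj a b →
    ∃ Z : Finset V, a ∉ Z ∧ b ∉ Z ∧ MSep G a b Z

/-- A collider path from `v` to `x` that is into `x` and all of whose
non-endpoint nodes are parents of `y`. -/
def ColliderPathInto (G : PMG V) (v x y : V) : Prop :=
  ∃ p : List V, IsPathFromTo G p v x ∧
    (∀ i, i + 2 < p.length → ColliderAt G p i) ∧
    (∃ a, p[p.length - 2]? = some a ∧ G.mark a x = some Mark.arrow) ∧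
    (∀ c ∈ p, c ≠ v → c ≠ x → G.DirEdge c y)

/-- The directed edge `x → y` is visible (in a MAG or PAG). -/
def Visible (G : PMG V) (x y : V) : Prop :=
  G.DirEdge x y ∧
  ∃ v, v ≠ y ∧ ¬ G.Adj v y ∧
    (G.mark v x = some Mark.arrow ∨ ColliderPathInto G v x y)

/-- `p` is a proper path from the node set `X` to the node set `Y`. -/
def ProperPath (G : PMG V) (X Y : Finset V) (p : List V) : Prop :=
  IsPath G p ∧ (∃ a ∈ X, p.head? = some a) ∧ (∃ b ∈ Y, p.getLast? = some b) ∧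
  (∀ c ∈ p.tail, c ∉ X)

/-- `p` starts with an edge satisfying `vis` out of its first node. -/
def StartsVisible (vis : V → V → Prop) (p : List V) : Prop :=
  ∃ a b, p[0]? = some a ∧ p[1]? = some b ∧ vis a b

/-- Adjustment amenability relative to `(X,Y)`, with visibility predicate `vis`. -/
def Amenable (G : PMG V) (vis : V → V → Prop) (X Y : Finset V) : Prop :=
  ∀ p, ProperPath G X Y p → PossDirAlong G p → StartsVisible vis p

/-- Forbidden nodes: possible descendants of a node `w ∉ X` lying on a proper
possibly causal path from `X` to `Y`. -/
def Forb (G : PMG V) (X Y : Finset V) : Set V :=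
  { v | ∃ w, w ∉ X ∧
      (∃ p, ProperPath G X Y p ∧ PossDirAlong G p ∧ w ∈ p) ∧
      PossDescendant G w v }

/-- Forbidden nodes in a DAG or MAG: descendants of a node `w ∉ X` lying on a
proper causal path from `X` to `Y`. -/
def ForbD (G : PMG V) (X Y : Finset V) : Set V :=
  { v | ∃ w, w ∉ X ∧
      (∃ p, ProperPath G X Y p ∧ DirectedAlong G p ∧ w ∈ p) ∧
      Descendant G w v }

/-- The generalized adjustment criterion (GAC) relative to `(X,Y)`, with
visibility predicate `vis`. -/
def GAC (G : PMG V) (vis : V → V → Prop) (X Y Z : Finset V) : Prop :=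
  Amenable G vis X Y ∧
  (∀ z ∈ Z, z ∉ Forb G X Y) ∧
  (∀ p, ProperPath G X Y p → DefStatus G p → ¬ PossDirAlong G p → ¬ MConn G Z p)

/-- The adjustment criterion (AC) for DAGs and MAGs relative to `(X,Y)`, with
visibility predicate `vis`. -/
def AC (H : PMG V) (vis : V → V → Prop) (X Y Z : Finset V) : Prop :=
  (∀ p, ProperPath H X Y p → DirectedAlong H p → StartsVisible vis p) ∧
  (∀ z ∈ Z, z ∉ ForbD H X Y) ∧
  (∀ p, ProperPath H X Y p → ¬ PossDirAlong H p → ¬ MConn H Z p)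

/-- `cls` is the Markov equivalence class of DAGs represented by the CPDAG `G`. -/
def IsCPDAGOf (G : PMG V) (cls : Set (PMG V)) : Prop :=
  cls.Nonempty ∧
  (∀ D ∈ cls, IsDAG D) ∧
  (∀ D ∈ cls, ∀ D', IsDAG D' → MarkovEquiv D D' → D' ∈ cls) ∧
  (∀ D ∈ cls, ∀ D' ∈ cls, MarkovEquiv D D') ∧
  (∀ D ∈ cls, ∀ a b, G.Adj a b ↔ D.Adj a b) ∧
  (∀ a b, G.Adj a b → (G.DirEdge a b ∨ G.NondirEdge a b)) ∧
  (∀ a b, G.DirEdge a b ↔ (G.Adj a b ∧ ∀ D ∈ cls, D.DirEdge a b))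

/-- `cls` is the Markov equivalence class of MAGs represented by the PAG `P`. -/
def IsPAGOf (P : PMG V) (cls : Set (PMG V)) : Prop :=
  cls.Nonempty ∧
  (∀ M ∈ cls, IsMAG M) ∧
  (∀ M ∈ cls, ∀ M', IsMAG M' → MarkovEquiv M M' → M' ∈ cls) ∧
  (∀ M ∈ cls, ∀ M' ∈ cls, MarkovEquiv M M') ∧
  (∀ M ∈ cls, ∀ a b, P.Adj a b ↔ M.Adj a b) ∧
  (∀ a b, P.mark a b = some Mark.arrow ↔ (P.Adj a b ∧ ∀ M ∈ cls, M.mark a b = some Mark.arrow)) ∧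
  (∀ a b, P.mark a b = some Mark.tail ↔ (P.Adj a b ∧ ∀ M ∈ cls, M.mark a b = some Mark.tail))

section Density

variable {Ω : Type} [Fintype V] [DecidableEq V] [Fintype Ω]

/-- `f` is a probability density (pmf) over the joint state space. -/
def IsDensity (f : (V → Ω) → ℝ) : Prop :=
  (∀ v, 0 ≤ f v) ∧ ∑ v, f v = 1

/-- The marginal density of the variables in `S`, evaluated at `v`. -/
noncomputable def margOn (f : (V → Ω) → ℝ) (S : Finset V) (v : V → Ω) : ℝ :=
  ∑ w : V → Ω, if ∀ i ∈ S, w i = v i then f w else 0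

/-- The conditional density of the variables in `A` given those in `B`, at `v`. -/
noncomputable def condOn (f : (V → Ω) → ℝ) (A B : Finset V) (v : V → Ω) : ℝ :=
  margOn f (A ∪ B) v / margOn f B v

/-- The parents of `i` in `G`. -/
noncomputable def parents (G : PMG V) (i : V) : Finset V :=
  Finset.univ.filter (fun j => G.DirEdge j i)

/-- `f` factorizes according to the DAG `G`. -/
def ConsistentWith (G : PMG V) (f : (V → Ω) → ℝ) : Prop :=
  ∀ v, f v = ∏ i, condOn f {i} (parents G i) v

/-- The post-intervention density `f(· | do(X = xval))` (truncated factorization). -/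
noncomputable def doDens (G : PMG V) (f : (V → Ω) → ℝ) (X : Finset V) (xval : V → Ω) :
    (V → Ω) → ℝ :=
  fun v => if ∀ i ∈ X, v i = xval i then ∏ i ∈ Xᶜ, condOn f {i} (parents G i) v else 0

/-- Overwrite `v` on `Z` by the assignment `w`. -/
noncomputable def patch (Z : Finset V) (v : V → Ω) (w : {i // i ∈ Z} → Ω) : V → Ω :=
  fun i => if h : i ∈ Z then w ⟨i, h⟩ else v i

end Density

/-- `Z` is an adjustment set relative to `(X,Y)` in the DAG `D`: for every finite state
space and every density consistent with `D`, the adjustment formula holds. -/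
def IsAdjSetDAG [Fintype V] [DecidableEq V] (D : PMG V) (X Y Z : Finset V) : Prop :=
  ∀ (Ω : Type) [Fintype Ω] [DecidableEq Ω] (f : (V → Ω) → ℝ),
    IsDensity f → ConsistentWith D f →
    ∀ v : V → Ω,
      margOn (doDens D f X v) Y v =
        if Z = ∅ then condOn f Y X v
        else ∑ w : ({i // i ∈ Z} → Ω),
          condOn f Y (X ∪ Z) (patch Z v w) * margOn f Z (patch Z v w)

/-- The marginal of a density over `V ⊕ L` on the observed variables `V`. -/
noncomputable def obsMargin {L : Type} [Fintype V] [Fintype L] [DecidableEq V] [DecidableEq L]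
    {Ω : Type} [Fintype Ω] (f : ((V ⊕ L) → Ω) → ℝ) : (V → Ω) → ℝ :=
  fun v => ∑ w : (V ⊕ L) → Ω, if ∀ i : V, w (Sum.inl i) = v i then f w else 0

/-- `M` is the MAG over the observed variables `V` of the DAG `D'` over `V ⊕ L`. -/
def IsMAGOverObs {L : Type} (D' : PMG (V ⊕ L)) (M : PMG V) : Prop :=
  (∀ a b : V, M.Adj a b ↔ (a ≠ b ∧ ∀ S : Finset V, a ∉ S → b ∉ S →
      ¬ MSep D' (Sum.inl a) (Sum.inl b) (S.image Sum.inl))) ∧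
  (∀ a b : V, M.Adj a b →
    ((M.mark a b = some Mark.arrow ↔ ¬ Descendant D' (Sum.inl b) (Sum.inl a)) ∧
     (M.mark a b = some Mark.tail ↔ Descendant D' (Sum.inl b) (Sum.inl a))))

/-- `Z` is an adjustment set relative to `(X,Y)` in the MAG `M`: for every DAG `D'`
with latent variables whose MAG over `V` is `M` and every consistent density,
the adjustment formula holds for the observed margin. -/
def IsAdjSetMAG [Fintype V] [DecidableEq V] (M : PMG V) (X Y Z : Finset V) : Prop :=
  ∀ (Ω L : Type) [Fintype Ω] [DecidableEq Ω] [Fintype L] [DecidableEq L]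
    (D' : PMG (V ⊕ L)) (f' : ((V ⊕ L) → Ω) → ℝ),
    IsDAG D' → IsMAGOverObs D' M → IsDensity f' → ConsistentWith D' f' →
    ∀ v : (V ⊕ L) → Ω,
      margOn (obsMargin (doDens D' f' (X.image Sum.inl) v)) Y (fun i => v (Sum.inl i)) =
        if Z = ∅ then condOn (obsMargin f') Y X (fun i => v (Sum.inl i))
        else ∑ w : ({i // i ∈ Z} → Ω),
          condOn (obsMargin f') Y (X ∪ Z) (patch Z (fun i => v (Sum.inl i)) w) *
            margOn (obsMargin f') Z (patch Z (fun i => v (Sum.inl i)) w)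

/-- The distance-from-`Z` of a node `q`: the length of a shortest directed path
(possibly of length 0) from `q` to a member of `Z`. -/
noncomputable def distZ (G : PMG V) (Z : Finset V) (q : V) : ℕ :=
  sInf { n | ∃ p, IsPath G p ∧ DirectedAlong G p ∧ p.head? = some q ∧
      (∃ z ∈ Z, p.getLast? = some z) ∧ p.length = n + 1 }

/-- The distance-from-`Z` of a path `p`: the sum of the distances-from-`Z`
of the colliders on `p`. -/
noncomputable def pathDistZ (G : PMG V) (Z : Finset V) (p : List V) : ℕ :=
  ∑ i ∈ Finset.range p.length,
    if ColliderAt G p i then (p[i+1]?.elim 0 (distZ G Z)) else 0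

end PMG

namespace PMG
variable {V : Type}

/-! ### Basic notions -/

def Arr (G : PMG V) (a b : V) : Prop := G.mark a b = some Mark.arrow

def An (G : PMG V) (a b : V) : Prop := Relation.ReflTransGen G.DirEdge a b

def AnS (G : PMG V) (S : Finset V) (a : V) : Prop := ∃ z ∈ S, An G a z

theorem adj_symm {G : PMG V} {a b : V} (h : G.Adj a b) : G.Adj b a := (G.symm a b).1 h

theorem adj_ne {G : PMG V} {a b : V} (h : G.Adj a b) : a ≠ b := by
  rintro rfl
  simp [Adj, G.irrefl] at h

theorem Arr.adj {G : PMG V} {a b : V} (h : G.Arr a b) : G.Adj a b := by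
  unfold Arr at h; simp [Adj, h]

theorem DirEdge.arr {G : PMG V} {a b : V} (h : G.DirEdge a b) : G.Arr a b := h.1

theorem DirEdge.adj {G : PMG V} {a b : V} (h : G.DirEdge a b) : G.Adj a b := h.arr.adj

theorem DirEdge.narr {G : PMG V} {a b : V} (h : G.DirEdge a b) : ¬ G.Arr b a := by
  intro h2; have := h.2; unfold Arr at h2; rw [h2] at this; simp at this

theorem DirEdge.an {G : PMG V} {a b : V} (h : G.DirEdge a b) : G.An a b :=
  Relation.ReflTransGen.single h

theorem An.trans {G : PMG V} {a b c : V} (h : G.An a b) (h' : G.An b c) : G.An a c :=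
  Relation.ReflTransGen.trans h h'

theorem dir_of_narr {G : PMG V} (hG : IsMixed G) {a b : V} (h : G.Adj a b) (h2 : ¬ G.Arr a b) :
    G.DirEdge b a := by
  rcases hG a b h with h | h | h
  · exact absurd h.1 h2
  · exact h
  · exact absurd h.1 h2

/-- Extract a simple path from reachability. -/
theorem exists_path {R : V → V → Prop} {a b : V} (h : Relation.ReflTransGen R a b) :
    ∃ p : List V, p ≠ [] ∧ p.Nodup ∧ p.head? = some a ∧ p.getLast? = some b ∧
      ∀ i c d, p[i]? = some c → p[i+1]? = some d → R c d := by
  induction h using Relation.ReflTransGen.head_induction_on with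
  | refl => exact ⟨[b], by simp, by simp, by simp, by simp, by
      intro i c d h1 h2
      simp at h2⟩
  | @head a c hac _ ih =>
    obtain ⟨p, hne, hnd, hh, hl, hR⟩ := ih
    by_cases ha : a ∈ p
    · obtain ⟨s, t, rfl⟩ := List.append_of_mem ha
      refine ⟨a :: t, by simp, ?_, by simp, ?_, ?_⟩
      · exact (List.nodup_append.1 hnd).2.1
      · rw [← hl]; simp [List.getLast?_append, List.getLast?_cons]
      · intro i c d h1 h2
        refine hR (s.length + i) c d ?_ ?_
        · rw [List.getElem?_append_right (by omega)]; simpa using h1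
        · rw [List.getElem?_append_right (by omega)]
          rw [show s.length + i + 1 - s.length = i + 1 by omega]; exact h2
    · refine ⟨a :: p, by simp, by simp [ha, hnd], by simp, ?_, ?_⟩
      · rw [List.getLast?_cons, hl]; simp
      · intro i c' d h1 h2
        cases i with
        | zero =>
          simp at h1 h2
          subst h1
          rw [List.head?_eq_getElem?] at hh
          rw [hh] at h2
          simp at h2; subst h2; exact hac
        | succ i => exact hR i c' d (by simpa using h1) (by simpa using h2)

theorem chain_of_succ {R : V → V → Prop} : ∀ {p : List V},
    (∀ i c d, p[i]? = some c → p[i+1]? = some d → R c d) → p.Chain' R := by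
  intro p h
  rw [List.Chain', List.isChain_iff_getElem]
  intro i hi
  exact h i _ _ (by simp) (by simp)

theorem succ_of_chain {R : V → V → Prop} {p : List V} (h : p.Chain' R) :
    ∀ i c d, p[i]? = some c → p[i+1]? = some d → R c d := by
  rw [List.Chain', List.isChain_iff_getElem] at h
  intro i c d h1 h2
  obtain ⟨h3, rfl⟩ := List.getElem?_eq_some_iff.1 h1
  obtain ⟨h4, rfl⟩ := List.getElem?_eq_some_iff.1 h2
  exact h i (by omega)

/-- Reachability along a list. -/
theorem reach_of_list {R : V → V → Prop} {p : List V} {a b : V}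
    (hR : ∀ i c d, p[i]? = some c → p[i+1]? = some d → R c d)
    (ha : p.head? = some a) (hb : p.getLast? = some b) : Relation.ReflTransGen R a b := by
  induction p generalizing a with
  | nil => simp at ha
  | cons x p ih =>
    simp at ha; subst ha
    cases p with
    | nil => simp at hb; subst hb; exact Relation.ReflTransGen.refl
    | cons y p =>
      refine Relation.ReflTransGen.head (hR 0 x y (by simp) (by simp)) ?_
      refine ih ?_ (by simp) (by simpa using hb)
      intro i c d h1 h2
      exact hR (i+1) c d (by simpa using h1) (by simpa using h2)

theorem desc_iff {G : PMG V} {a b : V} : Descendant G a b ↔ An G a b := by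
  constructor
  · rintro ⟨p, _, hd, ha, hb⟩
    exact reach_of_list hd ha hb
  · intro h
    obtain ⟨p, hne, hnd, hh, hl, hR⟩ := exists_path h
    exact ⟨p, ⟨hne, hnd, chain_of_succ fun i c d h1 h2 => (hR i c d h1 h2).adj⟩, hR, hh, hl⟩

theorem kk {G : PMG V} (hG : IsAncestral G) {a b : V} (h : G.Arr a b) (h2 : G.An b a) : False := by
  rcases hG.1 a b h.adj with h3 | h3 | h3
  · have := hG.2.1 a b (desc_iff.2 h3.an) (desc_iff.2 h2)
    exact adj_ne h.adj this
  · exact h3.narr h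
  · exact hG.2.2 b a (desc_iff.2 h2) h3

theorem dir_of_an {G : PMG V} (hG : IsAncestral G) {a b : V} (h : G.Adj a b) (h2 : G.An a b) :
    G.DirEdge a b :=
  dir_of_narr hG.1 (adj_symm h) fun h3 => kk hG h3 h2

/-- `a *→ b`, `b` ancestor of `c`, `a, c` adjacent: `a *→ c`. -/
theorem arr_trans {G : PMG V} (hG : IsAncestral G) {a b c : V} (h : G.Arr a b) (h2 : G.An b c)
    (h3 : G.Adj a c) : G.Arr a c := by
  by_contra h4
  exact kk hG h (h2.trans (dir_of_narr hG.1 h3 h4).an)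

/-! ### Walks -/

def Ok (G : PMG V) (S : Finset V) (a b c : V) : Prop :=
  (G.Arr a b → G.Arr c b → AnS G S b) ∧ (b ∈ S → G.Arr a b ∧ G.Arr c b)

def Wk (G : PMG V) (S : Finset V) (w : ℕ → V) (n : ℕ) : Prop :=
  (∀ i, i < n → G.Adj (w i) (w (i+1))) ∧ ∀ i, i + 2 ≤ n → Ok G S (w i) (w (i+1)) (w (i+2))

theorem Ok.symm {G : PMG V} {S : Finset V} {a b c : V} (h : Ok G S a b c) : Ok G S c b a :=
  ⟨fun h1 h2 => h.1 h2 h1, fun h1 => (h.2 h1).symm⟩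

theorem AnS.of_dir {G : PMG V} {S : Finset V} {a b : V} (h : G.An a b) (h2 : AnS G S b) :
    AnS G S a := by
  obtain ⟨z, hz, h3⟩ := h2
  exact ⟨z, hz, h.trans h3⟩

/-- join two walks by an edge -/
def jn (a : ℕ) (u v : ℕ → V) : ℕ → V := fun t => if t ≤ a then u t else v (t - a - 1)

theorem jn_le {a : ℕ} {u v : ℕ → V} {t : ℕ} (h : t ≤ a) : jn a u v t = u t := by simp [jn, h]

theorem jn_gt {a : ℕ} {u v : ℕ → V} {t s : ℕ} (h : t = a + 1 + s) : jn a u v t = v s := by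
  subst h
  simp only [jn]; rw [if_neg (by omega)]; congr 1; omega

theorem Wk.join {G : PMG V} {S : Finset V} {u v : ℕ → V} {a b : ℕ} (hu : Wk G S u a)
    (hv : Wk G S v b) (hadj : G.Adj (u a) (v 0))
    (h1 : ∀ k, a = k + 1 → Ok G S (u k) (u (k+1)) (v 0))
    (h2 : 1 ≤ b → Ok G S (u a) (v 0) (v 1)) : Wk G S (jn a u v) (a + b + 1) := by
  constructor
  · intro i hi
    rcases lt_trichotomy i a with h | h | h
    · rw [jn_le (by omega), jn_le (by omega)]; exact hu.1 i h
    · subst h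
      rw [jn_le (by omega), jn_gt (s := 0) (by omega)]; exact hadj
    · obtain ⟨k, rfl⟩ := Nat.exists_eq_add_of_lt h
      rw [jn_gt (s := k) (by omega), jn_gt (s := k+1) (by omega)]
      exact hv.1 k (by omega)
  · intro i hi
    by_cases h3 : i + 2 ≤ a
    · rw [jn_le (by omega), jn_le (by omega), jn_le (by omega)]; exact hu.2 i h3
    by_cases h4 : i + 1 = a
    · rw [jn_le (by omega), jn_le (by omega), jn_gt (s := 0) (by omega)]
      exact h1 i h4.symm
    by_cases h5 : i = a
    · rw [jn_le (by omega), jn_gt (s := 0) (by omega), jn_gt (s := 1) (by omega)]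
      subst h5
      exact h2 (by omega)
    obtain ⟨k, rfl⟩ := Nat.exists_eq_add_of_lt (show a < i by omega)
    rw [jn_gt (s := k) (by omega), jn_gt (s := k+1) (by omega), jn_gt (s := k+2) (by omega)]
    exact hv.2 k (by omega)

theorem Wk.pre {G : PMG V} {S : Finset V} {w : ℕ → V} {n k : ℕ} (h : Wk G S w n) (hk : k ≤ n) :
    Wk G S w k :=
  ⟨fun i hi => h.1 i (by omega), fun i hi => h.2 i (by omega)⟩

theorem Wk.suf {G : PMG V} {S : Finset V} {w : ℕ → V} {n k : ℕ} (h : Wk G S w n) :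
    Wk G S (fun t => w (k + t)) (n - k) :=
  ⟨fun i hi => h.1 (k + i) (by omega), fun i hi => h.2 (k+i) (by omega)⟩

theorem wk_zero {G : PMG V} {S : Finset V} (w : ℕ → V) : Wk G S w 0 :=
  ⟨fun i hi => by omega, fun i hi => by omega⟩

/-- splice: jump from `w l` to `w r` -/
theorem Wk.splice {G : PMG V} {S : Finset V} {w : ℕ → V} {n l r : ℕ} (h : Wk G S w n)
    (hl : l ≤ n) (hr : r ≤ n)
    (hadj : G.Adj (w l) (w r))
    (h1 : ∀ k, l = k + 1 → Ok G S (w k) (w (k+1)) (w r))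
    (h2 : r < n → Ok G S (w l) (w r) (w (r+1))) :
    Wk G S (jn l w (fun t => w (r + t))) (l + (n - r) + 1) := by
  apply (h.pre hl).join h.suf hadj h1
  intro hb
  exact h2 (by omega)

theorem Wk.fwd {G : PMG V} (hG : IsAncestral G) {S : Finset V} {w : ℕ → V} {n i : ℕ}
    (h : Wk G S w n) (hd : G.DirEdge (w i) (w (i+1))) :
    ∀ d, i + 1 + d ≤ n → AnS G S (w i) ∨
      (G.DirEdge (w (i + d)) (w (i + d + 1)) ∧ G.An (w (i+1)) (w (i + d + 1))) := by
  intro d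
  induction d with
  | zero => intro _; right; exact ⟨hd, Relation.ReflTransGen.refl⟩
  | succ d ih =>
    intro hle
    rcases ih (by omega) with h3 | ⟨h3, h4⟩
    · exact Or.inl h3
    · by_cases h5 : G.Arr (w (i + d + 2)) (w (i + d + 1))
      · left
        have := (h.2 (i + d) (by omega)).1 h3.arr h5
        exact AnS.of_dir (hd.an.trans h4) this
      · right
        have h6 := dir_of_narr hG.1 (adj_symm (h.1 (i + d + 1) (by omega))) h5
        exact ⟨h6, h4.trans h6.an⟩

theorem Wk.merge {G : PMG V} (hG : IsAncestral G) {S : Finset V} {w : ℕ → V} {n i j : ℕ}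
    (h : Wk G S w n) (hij : i + 1 < j) (hj : j < n) (he : w (i+1) = w j) :
    Ok G S (w i) (w (i+1)) (w (j+1)) := by
  obtain ⟨k, rfl⟩ := Nat.exists_eq_add_of_lt hij
  have o1 := h.2 i (by omega)
  have o2 := h.2 (i + 1 + k) (by omega)
  constructor
  · intro h1 h2
    by_cases h3 : G.Arr (w (i+2)) (w (i+1))
    · exact o1.1 h1 h3
    · have h4 := dir_of_narr hG.1 (adj_symm (h.1 (i + 1) (by omega))) h3
      rcases h.fwd hG (i := i+1) h4 k (by omega) with h5 | ⟨_, h6⟩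
      · exact h5
      · exfalso
        rw [← he] at h6
        exact kk hG h4.arr h6
  · intro hm
    refine ⟨(o1.2 hm).1, ?_⟩
    rw [he] at hm ⊢
    exact (o2.2 hm).2

/-- list of a walk -/
def pl (w : ℕ → V) (n : ℕ) : List V := (List.range (n+1)).map w

theorem pl_get (w : ℕ → V) (n i : ℕ) : (pl w n)[i]? = if i ≤ n then some (w i) else none := by
  unfold pl
  by_cases h : i ≤ n
  · simp [h, Nat.lt_succ_of_le h]
  · simp [h]

theorem pl_get_some {w : ℕ → V} {n i : ℕ} {a : V} (h : (pl w n)[i]? = some a) :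
    i ≤ n ∧ a = w i := by
  rw [pl_get] at h
  split_ifs at h with h1
  simp at h; exact ⟨h1, h.symm⟩

theorem pl_path {G : PMG V} {w : ℕ → V} {n : ℕ} (ha : ∀ i, i < n → G.Adj (w i) (w (i+1)))
    (hinj : ∀ i j, i < j → j ≤ n → w i ≠ w j) : IsPath G (pl w n) := by
  refine ⟨by simp [pl], ?_, ?_⟩
  · unfold pl
    apply List.Nodup.map_on _ List.nodup_range
    intro x hx y hy hxy
    simp at hx hy
    rcases lt_trichotomy x y with h | h | h
    · exact absurd hxy (hinj x y h (by omega))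
    · exact h
    · exact absurd hxy.symm (hinj y x h (by omega))
  · apply chain_of_succ
    intro i c d h1 h2
    obtain ⟨_, rfl⟩ := pl_get_some h1
    obtain ⟨h3, rfl⟩ := pl_get_some h2
    exact ha i (by omega)

theorem pl_head (w : ℕ → V) (n : ℕ) : (pl w n).head? = some (w 0) := by
  rw [List.head?_eq_getElem?, pl_get]; simp

theorem pl_length (w : ℕ → V) (n : ℕ) : (pl w n).length = n + 1 := by simp [pl]

theorem pl_last (w : ℕ → V) (n : ℕ) : (pl w n).getLast? = some (w n) := by
  rw [List.getLast?_eq_getElem?, pl_get, pl_length]; simp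

theorem pl_col {G : PMG V} {w : ℕ → V} {n i : ℕ} (h : ColliderAt G (pl w n) i) :
    i + 2 ≤ n ∧ G.Arr (w i) (w (i+1)) ∧ G.Arr (w (i+2)) (w (i+1)) := by
  obtain ⟨a, b, c, h1, h2, h3, h4, h5⟩ := h
  obtain ⟨_, rfl⟩ := pl_get_some h1
  obtain ⟨_, rfl⟩ := pl_get_some h2
  obtain ⟨h6, rfl⟩ := pl_get_some h3
  exact ⟨h6, h4, h5⟩

theorem pl_col_mk {G : PMG V} {w : ℕ → V} {n i : ℕ} (h : i + 2 ≤ n) (h1 : G.Arr (w i) (w (i+1)))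
    (h2 : G.Arr (w (i+2)) (w (i+1))) : ColliderAt G (pl w n) i :=
  ⟨w i, w (i+1), w (i+2), by rw [pl_get, if_pos (by omega)], by rw [pl_get, if_pos (by omega)],
    by rw [pl_get, if_pos (by omega)], h1, h2⟩

theorem pl_mconn {G : PMG V} (hG : IsMixed G) {S : Finset V} {w : ℕ → V} {n : ℕ}
    (h : Wk G S w n) : MConn G S (pl w n) := by
  refine ⟨?_, ?_, ?_⟩
  · intro i hi
    rw [pl_length] at hi
    by_cases h1 : G.Arr (w i) (w (i+1))
    · by_cases h2 : G.Arr (w (i+2)) (w (i+1))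
      · exact Or.inl (pl_col_mk (by omega) h1 h2)
      · right
        refine ⟨w i, w (i+1), w (i+2), by rw [pl_get, if_pos (by omega)],
          by rw [pl_get, if_pos (by omega)], by rw [pl_get, if_pos (by omega)], ?_⟩
        exact Or.inr (Or.inl (dir_of_narr hG (adj_symm (h.1 (i+1) (by omega))) h2).2)
    · right
      refine ⟨w i, w (i+1), w (i+2), by rw [pl_get, if_pos (by omega)],
          by rw [pl_get, if_pos (by omega)], by rw [pl_get, if_pos (by omega)], ?_⟩
      exact Or.inl (dir_of_narr hG (h.1 i (by omega)) h1).2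
  · rintro i b hb ⟨a, b', c, h1, h2, h3, h4⟩ hm
    obtain ⟨_, rfl⟩ := pl_get_some h1
    obtain ⟨_, rfl⟩ := pl_get_some h2
    obtain ⟨h6, rfl⟩ := pl_get_some h3
    obtain ⟨_, rfl⟩ := pl_get_some hb
    have := (h.2 i h6).2 hm
    unfold Arr at this
    rw [this.1, this.2] at h4
    simp at h4
  · intro i b hb hc
    obtain ⟨_, rfl⟩ := pl_get_some hb
    obtain ⟨h1, h2, h3⟩ := pl_col hc
    obtain ⟨z, hz, h4⟩ := (h.2 i h1).1 h2 h3
    exact ⟨z, hz, desc_iff.2 h4⟩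

theorem no_walk {G : PMG V} (hG : IsAncestral G) {S : Finset V} {a b : V} (hab : a ≠ b)
    (hs : MSep G a b S) : ∀ (n : ℕ) (w : ℕ → V), w 0 = a → w n = b → Wk G S w n → False := by
  intro n
  induction n using Nat.strong_induction_on with
  | _ n ih =>
    intro w h0 hn hw
    have hn0 : n ≠ 0 := by rintro rfl; exact hab (h0.symm.trans hn)
    by_cases hinj : ∀ i j, i < j → j ≤ n → w i ≠ w j
    · refine hs (pl w n) ⟨pl_path hw.1 hinj, ?_, ?_, ?_⟩ (pl_mconn hG.1 hw)
      · rw [pl_head, h0]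
      · rw [pl_last, hn]
      · rw [pl_length]; omega
    · push Not at hinj
      obtain ⟨i, j, hij, hj, he⟩ := hinj
      by_cases hi : i = 0
      · subst hi
        refine ih (n - j) (by omega) (fun t => w (j + t)) ?_ ?_ hw.suf
        · simpa using he ▸ h0
        · show w (j + (n - j)) = b
          rw [show j + (n - j) = n by omega]; exact hn
      by_cases hj' : j = n
      · subst hj'
        exact ih i hij w h0 (he.trans hn) (hw.pre (by omega))
      obtain ⟨k, rfl⟩ := Nat.exists_eq_succ_of_ne_zero hi
      refine ih (k + 1 + (n - (j+1)) + 1) (by omega) _ ?_ ?_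
        (hw.splice (l := k+1) (r := j+1) (by omega) (by omega) ?_ ?_ ?_)
      · rw [jn_le (by omega)]; exact h0
      · rw [jn_gt (s := n - (j+1)) (by omega)]
        rw [show j + 1 + (n - (j+1)) = n by omega]; exact hn
      · rw [show w (k+1) = w j from he]; exact hw.1 j (by omega)
      · intro k' hk'
        have : k' = k := by omega
        subst this
        exact hw.merge hG hij (by omega) he
      · intro hlt
        rw [show w (k+1) = w j from he]; exact hw.2 j (by omega)

/-! ### Discriminating paths -/

def Col (G : PMG V) (a b c : V) : Prop := G.Arr a b ∧ G.Arr c b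

theorem discS {G : PMG V} (hG : IsAncestral G) {S : Finset V} {u : ℕ → V} {m : ℕ} {c : V}
    (h0 : u 0 ≠ c) (hs : MSep G (u 0) c S)
    (hadj : ∀ t, t ≤ m → G.Adj (u t) (u (t+1)))
    (hcol : ∀ t, t < m → Col G (u t) (u (t+1)) (u (t+2)) ∧ u (t+1) ∈ S)
    (hc : G.Adj (u (m+1)) c) :
    Col G (u m) (u (m+1)) c ↔ u (m+1) ∉ S := by
  have hw : Wk G S u (m+1) := by
    refine ⟨fun i hi => hadj i (by omega), fun i hi => ?_⟩
    obtain ⟨h1, h2⟩ := hcol i (by omega)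
    exact ⟨fun _ _ => ⟨_, h2, Relation.ReflTransGen.refl⟩, fun _ => h1⟩
  by_contra hcon
  refine no_walk hG h0 hs (m + 1 + 0 + 1) (jn (m+1) u (fun _ => c)) ?_ ?_
    (hw.join (wk_zero _) hc ?_ ?_)
  · rw [jn_le (by omega)]
  · rw [jn_gt (s := 0) (by omega)]
  · intro k hk
    have : k = m := by omega
    subst this
    by_cases h : Col G (u k) (u (k+1)) c
    · have : u (k+1) ∈ S := by tauto
      exact ⟨fun _ _ => ⟨_, this, Relation.ReflTransGen.refl⟩, fun _ => h⟩
    · have : u (k+1) ∉ S := by tauto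
      exact ⟨fun h1 h2 => absurd ⟨h1, h2⟩ h, fun h => absurd h this⟩
  · intro h; omega

theorem discPar {G : PMG V} (hG : IsAncestral G) {S : Finset V} {u : ℕ → V} {m : ℕ} {c : V}
    (h0 : u 0 ≠ c) (hs : MSep G (u 0) c S)
    (hadj : ∀ t, t ≤ m → G.Adj (u t) (u (t+1)))
    (hcol : ∀ t, t < m → Col G (u t) (u (t+1)) (u (t+2)) ∧ G.DirEdge (u (t+1)) c) :
    ∀ t, t < m → u (t+1) ∈ S := by
  intro t
  induction t using Nat.strong_induction_on with
  | _ t ih =>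
    intro ht
    have := discS hG (m := t) h0 hs (fun s hs => hadj s (by omega))
      (fun s hs => ⟨(hcol s (by omega)).1, ih s hs (by omega)⟩) (hcol t ht).2.adj
    by_contra h
    exact (hcol t ht).2.narr (this.2 h).2

/-- Transfer of discriminating path status between Markov equivalent MAGs. -/
theorem discT {G H : PMG V} (hG : IsMAG G) (hH : IsMAG H) (hE : MarkovEquiv G H)
    (hA : ∀ a b, G.Adj a b ↔ H.Adj a b) {u : ℕ → V} {m : ℕ} {c : V}
    (h0 : u 0 ≠ c) (hn : ¬ G.Adj (u 0) c)
    (hadj : ∀ t, t ≤ m → G.Adj (u t) (u (t+1)))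
    (hcol : ∀ t, t < m → Col G (u t) (u (t+1)) (u (t+2)) ∧ G.DirEdge (u (t+1)) c)
    (hcol' : ∀ t, t < m → Col H (u t) (u (t+1)) (u (t+2)))
    (hc : G.Adj (u (m+1)) c) :
    (Col G (u m) (u (m+1)) c ↔ Col H (u m) (u (m+1)) c) ∧
      ∀ t, t < m → H.DirEdge (u (t+1)) c := by
  obtain ⟨S, hS1, hS2, hS⟩ := hG.2 _ _ h0 hn
  have hS' := (hE _ _ S h0 hS1 hS2).1 hS
  have hmem := discPar hG.1 h0 hS hadj hcol
  have hadj' : ∀ t, t ≤ m → H.Adj (u t) (u (t+1)) := fun t ht => (hA _ _).1 (hadj t ht)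
  constructor
  · rw [discS hG.1 h0 hS hadj (fun t ht => ⟨(hcol t ht).1, hmem t ht⟩) hc,
      discS hH.1 h0 hS' hadj' (fun t ht => ⟨hcol' t ht, hmem t ht⟩) ((hA _ _).1 hc)]
  · intro t ht
    have := discS hH.1 (m := t) h0 hS' (fun s hs => hadj' s (by omega))
      (fun s hs => ⟨hcol' s (by omega), hmem s (by omega)⟩) ((hA _ _).1 (hcol t ht).2.adj)
    have h2 : ¬ Col H (u t) (u (t+1)) c := fun h => this.1 h (hmem t ht)
    exact dir_of_narr hH.1.1 (adj_symm ((hA _ _).1 (hcol t ht).2.adj))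
      (fun h => h2 ⟨(hcol' t ht).1, h⟩)

/-- unshielded triples -/
theorem unshT {G H : PMG V} (hG : IsMAG G) (hH : IsMAG H) (hE : MarkovEquiv G H)
    (hA : ∀ a b, G.Adj a b ↔ H.Adj a b) {a b c : V} (hab : G.Adj a b) (hbc : G.Adj b c)
    (hne : a ≠ c) (hn : ¬ G.Adj a c) : Col G a b c ↔ Col H a b c := by
  have := discT hG hH hE hA (u := fun t => if t = 0 then a else b) (m := 0) (c := c)
    (by simpa using hne) (by simpa using hn) (by intro t ht; simp [show t = 0 by omega, hab])
    (by intro t ht; omega) (by intro t ht; omega) (by simpa using hbc)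
  simpa using this.1

end PMG

namespace PMG
variable {V : Type}

/-! ### PAG facts -/

structure Setup (P : PMG V) (cls : Set (PMG V)) (X Y Z : Finset V) : Prop where
  hP : IsPAGOf P cls
  hXY : Disjoint X Y
  hZ : Disjoint Z (X ∪ Y)
  hAm : Amenable P (Visible P) X Y
  hF : ∀ z ∈ Z, z ∉ Forb P X Y

/-- possibly directed edge -/
def PE (P : PMG V) (a b : V) : Prop := P.Adj a b ∧ ¬ P.Arr b a

def EY (P : PMG V) (X Y : Finset V) (v : V) : Prop :=
  v ∉ X ∧ ∃ y ∈ Y, Relation.ReflTransGen (fun a b => PE P a b ∧ b ∉ X) v y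

def Bd (P : PMG V) (X Y : Finset V) (x v : V) : Prop := P.DirEdge x v ∧ EY P X Y v

section pag
variable {P : PMG V} {cls : Set (PMG V)}

theorem pag_mag (hP : IsPAGOf P cls) {M : PMG V} (hM : M ∈ cls) : IsMAG M := hP.2.1 M hM

theorem pag_adj (hP : IsPAGOf P cls) {M : PMG V} (hM : M ∈ cls) (a b : V) : P.Adj a b ↔ M.Adj a b :=
  hP.2.2.2.2.1 M hM a b

theorem pag_equiv (hP : IsPAGOf P cls) {M N : PMG V} (hM : M ∈ cls) (hN : N ∈ cls) : MarkovEquiv M N :=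
  hP.2.2.2.1 M hM N hN

theorem pag_adj2 (hP : IsPAGOf P cls) {M N : PMG V} (hM : M ∈ cls) (hN : N ∈ cls) (a b : V) : M.Adj a b ↔ N.Adj a b :=
  (pag_adj hP hM a b).symm.trans (pag_adj hP hN a b)

theorem pag_arr (hP : IsPAGOf P cls) {M : PMG V} (hM : M ∈ cls) {a b : V} (h : P.Arr a b) : M.Arr a b :=
  ((hP.2.2.2.2.2.1 a b).1 h).2 M hM

theorem pag_arr_mk (hP : IsPAGOf P cls) {a b : V} (h : P.Adj a b) (h2 : ∀ M ∈ cls, M.Arr a b) : P.Arr a b :=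
  (hP.2.2.2.2.2.1 a b).2 ⟨h, h2⟩

theorem pag_tail (hP : IsPAGOf P cls) {M : PMG V} (hM : M ∈ cls) {a b : V} (h : P.mark a b = some Mark.tail) :
    M.mark a b = some Mark.tail :=
  ((hP.2.2.2.2.2.2 a b).1 h).2 M hM

theorem pag_tail_mk (hP : IsPAGOf P cls) {a b : V} (h : P.Adj a b) (h2 : ∀ M ∈ cls, M.mark a b = some Mark.tail) :
    P.mark a b = some Mark.tail :=
  (hP.2.2.2.2.2.2 a b).2 ⟨h, h2⟩

theorem pag_dir (hP : IsPAGOf P cls) {M : PMG V} (hM : M ∈ cls) {a b : V} (h : P.DirEdge a b) : M.DirEdge a b :=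
  ⟨pag_arr hP hM h.1, pag_tail hP hM h.2⟩

theorem pag_dir_mk (hP : IsPAGOf P cls) {a b : V} (h : P.Adj a b) (h2 : ∀ M ∈ cls, M.DirEdge a b) : P.DirEdge a b :=
  ⟨pag_arr_mk hP h fun M hM => (h2 M hM).1, pag_tail_mk hP (adj_symm h) fun M hM => (h2 M hM).2⟩

theorem pe_mk (hP : IsPAGOf P cls) {M : PMG V} (hM : M ∈ cls) {a b : V} (h : M.Adj a b) (h2 : ¬ M.Arr b a) :
    PE P a b :=
  ⟨(pag_adj hP hM a b).2 h, fun h3 => h2 (pag_arr hP hM h3)⟩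

theorem pe_of_dir (hP : IsPAGOf P cls) {M : PMG V} (hM : M ∈ cls) {a b : V} (h : M.DirEdge a b) : PE P a b :=
  pe_mk hP hM h.adj h.narr

theorem pe_of_an (hP : IsPAGOf P cls) {M : PMG V} (hM : M ∈ cls) {a b : V} (h : M.An a b) :
    Relation.ReflTransGen (PE P) a b :=
  Relation.ReflTransGen.mono (fun _ _ h => pe_of_dir hP hM h) _ _ h

end pag

theorem ey_cons {P : PMG V} {X Y : Finset V} {b c : V} (hb : b ∉ X) (h : PE P b c)
    (hc : EY P X Y c) : EY P X Y b := by
  obtain ⟨h1, y, hy, h2⟩ := hc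
  exact ⟨hb, y, hy, Relation.ReflTransGen.head ⟨h, h1⟩ h2⟩

theorem ey_path {P : PMG V} {X Y : Finset V} {x v : V} (hx : x ∈ X) (h : PE P x v)
    (hv : EY P X Y v) : ∃ p, ProperPath P X Y p ∧ PossDirAlong P p ∧ p[0]? = some x ∧
      p[1]? = some v := by
  obtain ⟨h1, y, hy, h2⟩ := hv
  obtain ⟨p, hne, hnd, hh, hl, hR⟩ := exists_path h2
  have hpX : ∀ c ∈ p, c ∉ X := by
    intro c hc
    obtain ⟨i, hi⟩ := List.mem_iff_getElem?.1 hc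
    cases i with
    | zero =>
      rw [List.head?_eq_getElem?] at hh
      rw [hh] at hi; simp at hi; subst hi; exact h1
    | succ i =>
      have hlt : i < p.length := by
        have := (List.getElem?_eq_some_iff.1 hi).1; omega
      exact (hR i p[i] c (by simp) hi).2
  have hR' : ∀ i c d, (x :: p)[i]? = some c → (x :: p)[i+1]? = some d → PE P c d := by
    intro i c d h3 h4
    cases i with
    | zero =>
      simp at h3 h4
      rw [List.head?_eq_getElem?] at hh
      rw [hh] at h4; simp at h4; subst h4; subst h3; exact h
    | succ i => exact (hR i c d (by simpa using h3) (by simpa using h4)).1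
  refine ⟨x :: p, ⟨⟨by simp, ?_, ?_⟩, ⟨x, hx, by simp⟩, ⟨y, hy, ?_⟩, by simpa using hpX⟩, ?_, by simp, ?_⟩
  · exact List.nodup_cons.2 ⟨fun hc => hpX x hc hx, hnd⟩
  · exact chain_of_succ fun i c d h3 h4 => (hR' i c d h3 h4).1
  · rw [List.getLast?_cons, hl]; simp
  · exact fun i c d h3 h4 => (hR' i c d h3 h4).2
  · rw [List.head?_eq_getElem?] at hh; simpa using hh

theorem Setup.vis {P : PMG V} {cls : Set (PMG V)} {X Y Z : Finset V} (s : Setup P cls X Y Z)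
    {x v : V} (hx : x ∈ X) (h : PE P x v) (hv : EY P X Y v) : Visible P x v := by
  obtain ⟨p, h1, h2, h3, h4⟩ := ey_path hx h hv
  obtain ⟨a, b, h5, h6, h7⟩ := s.hAm p h1 h2
  rw [h3] at h5; rw [h4] at h6
  simp at h5 h6; subst h5; subst h6; exact h7

theorem Setup.bd {P : PMG V} {cls : Set (PMG V)} {X Y Z : Finset V} (s : Setup P cls X Y Z)
    {x v : V} (hx : x ∈ X) (h : PE P x v) (hv : EY P X Y v) : Bd P X Y x v :=
  ⟨(s.vis hx h hv).1, hv⟩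

theorem Setup.forb {P : PMG V} {cls : Set (PMG V)} {X Y Z : Finset V} (s : Setup P cls X Y Z)
    {x v z : V} (hx : x ∈ X) (h : PE P x v) (hv : EY P X Y v)
    (hz : z ∈ Z) (hr : Relation.ReflTransGen (PE P) v z) : False := by
  obtain ⟨p, h1, h2, h3, h4⟩ := ey_path hx h hv
  refine s.hF z hz ⟨v, hv.1, ⟨p, h1, h2, List.mem_iff_getElem?.2 ⟨1, h4⟩⟩, ?_⟩
  obtain ⟨q, hne, hnd, hh, hl, hR⟩ := exists_path hr
  exact ⟨q, ⟨hne, hnd, chain_of_succ fun i c d h1 h2 => (hR i c d h1 h2).1⟩,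
    fun i c d h1 h2 => (hR i c d h1 h2).2, hh, hl⟩

theorem vis_fun {P : PMG V} {x y : V} (h : Visible P x y) : ∃ (k : ℕ) (u : ℕ → V),
    u 0 ≠ y ∧ ¬ P.Adj (u 0) y ∧ u (k+1) = x ∧ (∀ t, t ≤ k → P.Adj (u t) (u (t+1))) ∧
    (∀ t, t < k → Col P (u t) (u (t+1)) (u (t+2)) ∧ P.DirEdge (u (t+1)) y) ∧
    P.Arr (u k) (u (k+1)) := by
  obtain ⟨hd, v, hvy, hna, h | h⟩ := h
  · refine ⟨0, fun t => if t = 0 then v else x, by simpa using hvy, by simpa using hna, by simp,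
      ?_, by intro t ht; omega, by simpa [Arr] using h⟩
    intro t ht
    simp [show t = 0 by omega]
    exact Arr.adj h
  · obtain ⟨p, ⟨⟨_, hnd, hch⟩, hh, hl, h2⟩, hcol, ⟨a, ha1, ha2⟩, hpar⟩ := h
    obtain ⟨k, hk⟩ : ∃ k, p.length = k + 2 := ⟨p.length - 2, by omega⟩
    have hget : ∀ t, t < p.length → p[t]? = some (p.getD t x) := by
      intro t ht
      simp [List.getD, ht]
    have h0 : p.getD 0 x = v := by
      have := hget 0 (by omega)
      rw [← List.head?_eq_getElem?, hh] at this
      simpa using this.symm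
    have hlast : p.getD (k+1) x = x := by
      have := hget (k+1) (by omega)
      rw [List.getLast?_eq_getElem?, hk] at hl
      rw [show k + 2 - 1 = k + 1 by omega] at hl
      rw [hl] at this
      simpa using this.symm
    have hinj : ∀ i j, i < p.length → j < p.length → p.getD i x = p.getD j x → i = j := by
      intro i j hi hj he
      have h1 := hget i hi
      rw [he, ← hget j hj] at h1
      exact (List.getElem?_inj hi hnd).1 h1
    refine ⟨k, fun t => p.getD t x, ?_, ?_, hlast, ?_, ?_, ?_⟩
    · simpa only [h0] using hvy
    · simpa only [h0] using hna
    · intro t ht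
      exact succ_of_chain hch t _ _ (hget t (by omega)) (hget (t+1) (by omega))
    · intro t ht
      constructor
      · obtain ⟨a, b, c, h1, h2, h3, h4, h5⟩ := hcol t (by omega)
        rw [hget _ (by omega)] at h1 h2 h3
        simp only [Option.some.injEq] at h1 h2 h3
        subst h1; subst h2; subst h3
        exact ⟨h4, h5⟩
      · apply hpar
        · exact List.mem_iff_getElem?.2 ⟨_, hget (t+1) (by omega)⟩
        · intro he
          rw [← h0] at he
          have := hinj _ _ (by omega) (by omega) he
          omega
        · intro he
          conv at he => rhs; rw [← hlast]
          have := hinj _ _ (by omega) (by omega) he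
          omega
    · rw [show p.length - 2 = k by omega, hget k (by omega)] at ha1
      simp only [Option.some.injEq] at ha1
      show P.Arr (p.getD k x) (p.getD (k+1) x)
      rw [hlast, ha1]; exact ha2

end PMG

namespace PMG
variable {V : Type}

/-! ### Minimal walks -/

structure GW (P M : PMG V) (X Y Z : Finset V) (w : ℕ → V) (n : ℕ) : Prop where
  wk : Wk M Z w n
  h0 : w 0 ∈ X
  hn : w n ∈ Y
  px : ∀ t, 1 ≤ t → t ≤ n → w t ∉ X
  nb : ¬ Bd P X Y (w 0) (w 1)

structure Core (P : PMG V) (cls : Set (PMG V)) (X Y Z : Finset V) (M : PMG V) (w : ℕ → V) (n : ℕ) :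
    Prop where
  s : Setup P cls X Y Z
  hM : M ∈ cls
  gw : GW P M X Y Z w n
  hmin : ∀ w' n', GW P M X Y Z w' n' → n ≤ n'

variable {P : PMG V} {cls : Set (PMG V)} {X Y Z : Finset V} {M : PMG V} {w : ℕ → V} {n : ℕ}

theorem Core.anc (c : Core P cls X Y Z M w n) : IsAncestral M := (pag_mag c.s.hP c.hM).1

theorem Core.no_splice (c : Core P cls X Y Z M w n) {l r : ℕ} (hlr : l + 1 < r) (hr : r ≤ n)
    (hadj : M.Adj (w l) (w r))
    (h1 : ∀ k, l = k + 1 → Ok M Z (w k) (w (k+1)) (w r))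
    (h2 : r < n → Ok M Z (w l) (w r) (w (r+1)))
    (hb : l = 0 → ¬ Bd P X Y (w 0) (w r)) : False := by
  have hw := c.gw.wk.splice (l := l) (r := r) (by omega) hr hadj h1 h2
  have : n ≤ l + (n - r) + 1 := by
    refine c.hmin _ _ ⟨hw, ?_, ?_, ?_, ?_⟩
    · rw [jn_le (by omega)]; exact c.gw.h0
    · rw [jn_gt (s := n - r) (by omega), show r + (n - r) = n by omega]; exact c.gw.hn
    · intro t ht1 ht2
      by_cases h : t ≤ l
      · rw [jn_le h]; exact c.gw.px t ht1 (by omega)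
      · rw [jn_gt (s := t - l - 1) (by omega)]; exact c.gw.px _ (by omega) (by omega)
    · rw [jn_le (by omega)]
      by_cases h : l = 0
      · rw [jn_gt (s := 0) (by omega)]; exact hb h
      · rw [jn_le (by omega)]; exact c.gw.nb
  omega

theorem Core.inj (c : Core P cls X Y Z M w n) : ∀ i j, i < j → j ≤ n → w i ≠ w j := by
  intro i j hij hj he
  have hi : i ≠ 0 := by
    rintro rfl
    exact c.gw.px j (by omega) hj (he ▸ c.gw.h0)
  obtain ⟨k, rfl⟩ := Nat.exists_eq_succ_of_ne_zero hi
  by_cases hjn : j = n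
  · subst hjn
    have := c.hmin w (k+1) ⟨c.gw.wk.pre (by omega), c.gw.h0, he ▸ c.gw.hn,
      fun t h1 h2 => c.gw.px t h1 (by omega), c.gw.nb⟩
    omega
  · refine c.no_splice (l := k+1) (r := j+1) (by omega) (by omega) ?_ ?_ ?_ (by omega)
    · rw [show w (k+1) = w j from he]; exact c.gw.wk.1 j (by omega)
    · intro k' hk'
      have : k' = k := by omega
      subst this
      exact c.gw.wk.merge c.anc hij (by omega) he
    · intro hlt
      rw [show w (k+1) = w j from he]; exact c.gw.wk.2 j (by omega)

theorem ok_joint (hG : IsMixed M) {a b q r : V} (ho : Ok M Z a b q) (hadj : M.Adj b r)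
    (h1 : M.Arr r b → M.Arr q b ∨ AnS M Z b)
    (h2 : b ∈ Z → M.Arr a b → M.Arr q b → M.DirEdge b r → False) : Ok M Z a b r := by
  constructor
  · intro h3 h4
    rcases h1 h4 with h5 | h5
    · exact ho.1 h3 h5
    · exact h5
  · intro hb
    obtain ⟨h3, h4⟩ := ho.2 hb
    refine ⟨h3, ?_⟩
    by_contra h5
    exact h2 hb h3 h4 (dir_of_narr hG (adj_symm hadj) h5)

theorem ok_same {a b q r : V} (ho : Ok M Z a b q) (h1 : M.Arr a b) (h2 : M.Arr r b) : Ok M Z r b q :=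
  ⟨fun _ h => ho.1 h1 h, fun h => ⟨h2, (ho.2 h).2⟩⟩

theorem maxL (g : ℕ → Prop) (j : ℕ) : ∃ l, l ≤ j ∧ (∀ t, l ≤ t → t < j → g t) ∧
    ∀ k, l = k + 1 → ¬ g k := by
  induction j with
  | zero => exact ⟨0, le_rfl, fun t _ _ => by omega, fun k hk => by omega⟩
  | succ j ih =>
    by_cases h : g j
    · obtain ⟨l, h1, h2, h3⟩ := ih
      refine ⟨l, by omega, fun t ht1 ht2 => ?_, h3⟩
      by_cases ht : t = j
      · subst ht; exact h
      · exact h2 t ht1 (by omega)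
    · refine ⟨j+1, le_rfl, fun t _ _ => by omega, fun k hk => ?_⟩
      rw [show k = j by omega]; exact h

theorem minR (g : ℕ → Prop) (s n : ℕ) (hs : s + 1 ≤ n) : ∃ r, s + 1 ≤ r ∧ r ≤ n ∧
    (∀ t, s ≤ t → t + 1 < r → g t) ∧ (r < n → ¬ g (r - 1)) := by
  obtain ⟨d, rfl⟩ := Nat.exists_eq_add_of_le hs
  induction d generalizing s with
  | zero => exact ⟨s+1, le_rfl, by omega, fun t _ _ => by omega, fun h => by omega⟩
  | succ d ih =>
    by_cases h : g s
    · obtain ⟨r, h1, h2, h3, h4⟩ := ih (s+1) (by omega)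
      refine ⟨r, by omega, by omega, fun t ht1 ht2 => ?_, fun h => h4 (by omega)⟩
      by_cases ht : t = s
      · subst ht; exact h
      · exact h3 t (by omega) ht2
    · exact ⟨s+1, le_rfl, by omega, fun t _ _ => by omega, fun _ => by simpa using h⟩

/-- collider in `Z` at position `t+1` -/
def CZ (M : PMG V) (Z : Finset V) (w : ℕ → V) (t : ℕ) : Prop :=
  w (t+1) ∈ Z ∧ Col M (w t) (w (t+1)) (w (t+2))

def TL (P M : PMG V) (X Y Z : Finset V) (w : ℕ → V) (j l : ℕ) : Prop :=
  l ≤ j ∧ (∀ t, l ≤ t → t < j → CZ M Z w t ∧ M.DirEdge (w (t+1)) (w (j+2))) ∧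
    ((¬ M.Adj (w l) (w (j+2)) ∧ l < j) ∨ (l = 0 ∧ Bd P X Y (w 0) (w (j+2))))

def TR (M : PMG V) (Z : Finset V) (w : ℕ → V) (n j r : ℕ) : Prop :=
  j + 2 < r ∧ r ≤ n ∧ (∀ t, j + 1 ≤ t → t + 1 < r → CZ M Z w t ∧ M.DirEdge (w (t+1)) (w j)) ∧
    ¬ M.Adj (w r) (w j)

theorem Core.classify (c : Core P cls X Y Z M w n) {j : ℕ} (hj : j + 2 ≤ n)
    (hs : M.Adj (w j) (w (j+2))) :
    (∃ l, TL P M X Y Z w j l) ∨ (∃ r, TR M Z w n j r) := by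
  have ha := c.anc
  have wk := c.gw.wk
  obtain ⟨l, hl1, hl2, hl3⟩ := maxL (fun t => CZ M Z w t ∧ M.DirEdge (w (t+1)) (w (j+2))) j
  obtain ⟨r, hr1, hr2, hr3, hr4⟩ := minR (fun t => CZ M Z w t ∧ M.DirEdge (w (t+1)) (w j))
    (j+1) n (by omega)
  have hB1 := wk.1 j (by omega)
  have hB2 := wk.1 (j+1) (by omega)
  by_contra hcon
  push Not at hcon
  obtain ⟨hc1, hc2⟩ := hcon
  by_cases hlj : l < j
  · -- left breaking
    have hnadj : M.Adj (w l) (w (j+2)) := by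
      by_contra h
      exact hc1 l ⟨hl1, hl2, Or.inl ⟨h, hlj⟩⟩
    obtain ⟨⟨_, hcl⟩, hdl⟩ := hl2 l le_rfl hlj
    have harr : M.Arr (w l) (w (j+2)) := arr_trans ha hcl.1 hdl.an hnadj
    obtain ⟨k, rfl⟩ : ∃ k, j = k + 1 := ⟨j - 1, by omega⟩
    obtain ⟨⟨_, hck⟩, hdk⟩ := hl2 k (by omega) (by omega)
    have hBC : M.Arr (w (k+2)) (w (k+3)) := by
      by_contra h
      exact kk ha hck.2 (hdk.an.trans (dir_of_narr ha.1 hB2 h).an)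
    refine c.no_splice (l := l) (r := k+1+2) (by omega) hj hnadj ?_ ?_ ?_
    · intro k' hk'
      subst hk'
      refine ok_joint ha.1 (wk.2 k' (by omega)) hnadj ?_ ?_
      · intro h
        left
        by_contra h2
        exact kk ha h ((dir_of_narr ha.1 (adj_symm (wk.1 (k'+1) (by omega))) h2).an.trans hdl.an)
      · intro h1 h2 h3 h4
        exact hl3 k' rfl ⟨⟨h1, h2, h3⟩, h4⟩
    · intro hlt
      exact ok_same (wk.2 (k+2) (by omega)) hBC harr
    · intro h0 hb
      exact hc1 l ⟨hl1, hl2, Or.inr ⟨h0, hb⟩⟩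
  have hlj : l = j := by omega
  subst hlj
  by_cases hrj : l + 2 < r
  · have hnadj : M.Adj (w r) (w l) := by
      by_contra h
      exact hc2 r ⟨hrj, hr2, hr3, h⟩
    obtain ⟨m, rfl⟩ : ∃ m, r = m + 2 := ⟨r - 2, by omega⟩
    obtain ⟨⟨_, hcr⟩, hdr⟩ := hr3 m (by omega) (by omega)
    have harr : M.Arr (w (m+2)) (w l) := arr_trans ha hcr.2 hdr.an hnadj
    obtain ⟨⟨_, hck⟩, hdk⟩ := hr3 (l+1) (by omega) (by omega)
    have hBA : M.Arr (w (l+1)) (w l) := by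
      by_contra h
      exact kk ha hck.1 (hdk.an.trans (dir_of_narr ha.1 (adj_symm hB1) h).an)
    refine c.no_splice (l := l) (r := m+2) (by omega) hr2 (adj_symm hnadj) ?_ ?_ ?_
    · intro k' hk'
      subst hk'
      exact (ok_same (wk.2 k' (by omega)).symm hBA harr).symm
    · intro hlt
      refine (ok_joint ha.1 (wk.2 (m+1) (by omega)).symm hnadj ?_ ?_).symm
      · intro h
        left
        by_contra h2
        exact kk ha h ((dir_of_narr ha.1 (wk.1 (m+1) (by omega)) h2).an.trans hdr.an)
      · intro h1 h2 h3 h4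
        exact hr4 hlt ⟨⟨h1, h3, h2⟩, h4⟩
    · intro h0 hb
      subst h0
      exact (pag_dir c.s.hP c.hM hb.1).narr harr
  have hrj : r = l + 2 := by omega
  subst hrj
  refine c.no_splice (l := l) (r := l+2) (by omega) hr2 hs ?_ ?_ ?_
  · intro k' hk'
    subst hk'
    refine ok_joint ha.1 (wk.2 k' (by omega)) hs ?_ ?_
    · intro h
      by_cases h2 : M.Arr (w (k'+2)) (w (k'+1))
      · exact Or.inl h2
      · right
        have h3 := dir_of_narr ha.1 (adj_symm hB1) h2
        exact AnS.of_dir h3.an ((wk.2 (k'+1) (by omega)).1 h3.arr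
          (arr_trans ha h h3.an (adj_symm hB2)))
    · intro h1 h2 h3 h4
      exact hl3 k' rfl ⟨⟨h1, h2, h3⟩, h4⟩
  · intro hlt
    refine (ok_joint ha.1 (wk.2 (l+1) (by omega)).symm (adj_symm hs) ?_ ?_).symm
    · intro h
      by_cases h2 : M.Arr (w (l+1)) (w (l+2))
      · exact Or.inl h2
      · right
        have h3 := dir_of_narr ha.1 hB2 h2
        exact AnS.of_dir h3.an ((wk.2 l (by omega)).1
          (arr_trans ha h h3.an hB1) h3.arr)
    · intro h1 h2 h3 h4
      exact hr4 hlt ⟨⟨h1, h3, h2⟩, h4⟩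
  · intro h0 hb
    exact hc1 l ⟨le_rfl, fun t _ _ => by omega, Or.inr ⟨h0, h0 ▸ hb⟩⟩

/-! ### Invariance of status -/

def Gd (M N : PMG V) (w : ℕ → V) (j : ℕ) : Prop :=
  (Col M (w j) (w (j+1)) (w (j+2)) → Col N (w j) (w (j+1)) (w (j+2))) ∧
  (¬ Col M (w j) (w (j+1)) (w (j+2)) → ¬ Col N (w j) (w (j+1)) (w (j+2)) ∧
    (M.DirEdge (w j) (w (j+2)) → N.DirEdge (w (j+1)) (w (j+2))) ∧
    (M.DirEdge (w (j+2)) (w j) → N.DirEdge (w (j+1)) (w j)))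

theorem not_both_dir {a b : V} (h : M.DirEdge a b) (h2 : M.DirEdge b a) : False := h.narr h2.arr

/-- noncollider at `b` next to `a` with `a → c` gives `b → c`. -/
theorem dir_of_ncol (ha : IsAncestral M) {a b c : V} (hab : M.Adj a b) (hbc : M.Adj b c)
    (hn : ¬ Col M a b c) (hac : M.DirEdge a c) : M.DirEdge b c := by
  by_cases h : M.Arr a b
  · exact dir_of_narr ha.1 (adj_symm hbc) fun h2 => hn ⟨h, h2⟩
  · exact dir_of_an ha hbc ((dir_of_narr ha.1 hab h).an.trans hac.an)

theorem gd_of_left {N : PMG V} (hN : IsAncestral N) {j : ℕ}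
    (hab : N.Adj (w j) (w (j+1))) (hbc : N.Adj (w (j+1)) (w (j+2)))
    (hiff : Col M (w j) (w (j+1)) (w (j+2)) ↔ Col N (w j) (w (j+1)) (w (j+2)))
    (hM : M.DirEdge (w j) (w (j+2))) (hNd : N.DirEdge (w j) (w (j+2))) : Gd M N w j :=
  ⟨hiff.1, fun h => ⟨fun h2 => h (hiff.2 h2), fun _ => dir_of_ncol hN hab hbc (fun h2 => h (hiff.2 h2))
    hNd, fun h2 => (not_both_dir hM h2).elim⟩⟩

theorem Col.symm {a b c : V} (h : Col M a b c) : Col M c b a := ⟨h.2, h.1⟩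

theorem gd_of_right {N : PMG V} (hN : IsAncestral N) {j : ℕ}
    (hab : N.Adj (w j) (w (j+1))) (hbc : N.Adj (w (j+1)) (w (j+2)))
    (hiff : Col M (w j) (w (j+1)) (w (j+2)) ↔ Col N (w j) (w (j+1)) (w (j+2)))
    (hM : M.DirEdge (w (j+2)) (w j)) (hNd : N.DirEdge (w (j+2)) (w j)) : Gd M N w j :=
  ⟨hiff.1, fun h => ⟨fun h2 => h (hiff.2 h2), fun h2 => (not_both_dir hM h2).elim,
    fun _ => dir_of_ncol hN (adj_symm hbc) (adj_symm hab) (fun h2 => h (hiff.2 h2.symm)) hNd⟩⟩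

theorem Core.gd_unsh (c : Core P cls X Y Z M w n) {N : PMG V} (hN : N ∈ cls) {j : ℕ}
    (hj : j + 2 ≤ n) (hs : ¬ M.Adj (w j) (w (j+2))) : Gd M N w j := by
  have h := unshT (pag_mag c.s.hP c.hM) (pag_mag c.s.hP hN) (pag_equiv c.s.hP c.hM hN)
    (pag_adj2 c.s.hP c.hM hN) (c.gw.wk.1 j (by omega)) (c.gw.wk.1 (j+1) (by omega))
    (c.inj j (j+2) (by omega) hj) hs
  exact ⟨h.1, fun h1 => ⟨fun h2 => h1 (h.2 h2), fun h2 => absurd h2.adj hs,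
    fun h2 => absurd (adj_symm h2.adj) hs⟩⟩

theorem Core.gd_R (c : Core P cls X Y Z M w n) {N : PMG V} (hN : N ∈ cls) {j r : ℕ}
    (hT : TR M Z w n j r) (hg : ∀ t, j + 1 ≤ t → t + 1 < r → Gd M N w t) : Gd M N w j := by
  obtain ⟨h1, h2, h3, h4⟩ := hT
  have wk := c.gw.wk
  have hA := pag_adj2 c.s.hP c.hM hN
  obtain ⟨m, rfl⟩ : ∃ m, r = j + 2 + m := ⟨r - (j+2), by omega⟩
  have key := discT (pag_mag c.s.hP c.hM) (pag_mag c.s.hP hN) (pag_equiv c.s.hP c.hM hN)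
    hA (u := fun t => w (j + 2 + m - t)) (m := m) (c := w j)
    (by simpa using (c.inj j (j+2+m) (by omega) h2).symm) (by simpa using h4)
    (by
      intro t ht
      have := wk.1 (j + 2 + m - (t+1)) (by omega)
      rw [show j + 2 + m - (t+1) + 1 = j + 2 + m - t by omega] at this
      exact adj_symm this)
    (by
      intro t ht
      have := h3 (j + 2 + m - (t+2)) (by omega) (by omega)
      rw [CZ, show j + 2 + m - (t+2) + 1 = j + 2 + m - (t+1) by omega,
        show j + 2 + m - (t+2) + 2 = j + 2 + m - t by omega] at this
      exact ⟨this.1.2.symm, this.2⟩)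
    (by
      intro t ht
      have := (hg (j + 2 + m - (t+2)) (by omega) (by omega)).1
        (h3 (j + 2 + m - (t+2)) (by omega) (by omega)).1.2
      rw [show j + 2 + m - (t+2) + 1 = j + 2 + m - (t+1) by omega,
        show j + 2 + m - (t+2) + 2 = j + 2 + m - t by omega] at this
      exact this.symm)
    (by
      show M.Adj (w (j + 2 + m - (m+1))) (w j)
      rw [show j + 2 + m - (m+1) = j + 1 by omega]
      exact adj_symm (wk.1 j (by omega)))
  obtain ⟨k1, k2⟩ := key
  simp only [show j + 2 + m - (m+1) = j + 1 by omega, show j + 2 + m - m = j + 2 by omega] at k1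
  have k3 := k2 (m-1) (by omega)
  simp only [show j + 2 + m - (m-1+1) = j + 2 by omega] at k3
  refine gd_of_right (pag_mag c.s.hP hN).1 ((hA _ _).1 (wk.1 j (by omega)))
    ((hA _ _).1 (wk.1 (j+1) (by omega)))
    ⟨fun h => (k1.1 h.symm).symm, fun h => (k1.2 h.symm).symm⟩ (h3 (j+1) le_rfl h1).2 k3

/-- the walk `visible path ++ w` version -/
theorem Core.disc_vis (c : Core P cls X Y Z M w n) {N : PMG V} (hN : N ∈ cls) {j : ℕ}
    (hj : j + 2 ≤ n)
    (hp : ∀ t, t < j → CZ M Z w t ∧ M.DirEdge (w (t+1)) (w (j+2)))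
    (hb : Bd P X Y (w 0) (w (j+2)))
    (hg : ∀ t, t < j → Gd M N w t)
    (hM1 : M.Arr (w 1) (w 0)) (hN1 : N.Arr (w 1) (w 0)) : Gd M N w j := by
  have wk := c.gw.wk
  have hP := c.s.hP
  have hA := pag_adj2 hP c.hM hN
  have hvis := c.s.vis c.gw.h0 ⟨hb.1.adj, hb.1.narr⟩ hb.2
  obtain ⟨k, u, hu1, hu2, hu3, hu4, hu5, hu6⟩ := vis_fun hvis
  rw [hu3] at hu6
  have key := discT (pag_mag hP c.hM) (pag_mag hP hN) (pag_equiv hP c.hM hN)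
    hA (u := jn k u w) (m := k + j + 1) (c := w (j+2))
    (by rw [jn_le (by omega)]; exact hu1)
    (by rw [jn_le (by omega)]; rw [← pag_adj hP c.hM]; exact hu2)
    (by
      intro t ht
      rcases lt_trichotomy t k with h | h | h
      · rw [jn_le (by omega), jn_le (by omega), ← pag_adj hP c.hM]; exact hu4 t (by omega)
      · subst h
        rw [jn_le (by omega), jn_gt (s := 0) (by omega)]; exact (pag_arr hP c.hM hu6).adj
      · rw [jn_gt (s := t - k - 1) (by omega), jn_gt (s := t - k - 1 + 1) (by omega)]
        exact wk.1 _ (by omega))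
    (by
      intro t ht
      by_cases h : t + 2 ≤ k
      · rw [jn_le (by omega), jn_le (by omega), jn_le (by omega)]
        obtain ⟨q1, q2⟩ := hu5 t (by omega)
        exact ⟨⟨pag_arr hP c.hM q1.1, pag_arr hP c.hM q1.2⟩, pag_dir hP c.hM q2⟩
      by_cases h2 : t + 1 = k
      · rw [jn_le (by omega), jn_le (by omega), jn_gt (s := 0) (by omega)]
        obtain ⟨q1, q2⟩ := hu5 t (by omega)
        rw [show t + 2 = k + 1 by omega, hu3] at q1
        exact ⟨⟨pag_arr hP c.hM q1.1, pag_arr hP c.hM q1.2⟩, pag_dir hP c.hM q2⟩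
      by_cases h3 : t = k
      · subst h3
        rw [jn_le (by omega), jn_gt (s := 0) (by omega), jn_gt (s := 1) (by omega)]
        exact ⟨⟨pag_arr hP c.hM hu6, hM1⟩, pag_dir hP c.hM hb.1⟩
      · obtain ⟨q1, q2⟩ := hp (t - k - 1) (by omega)
        rw [jn_gt (s := t - k - 1) (by omega), jn_gt (s := t - k - 1 + 1) (by omega),
          jn_gt (s := t - k - 1 + 2) (by omega)]
        exact ⟨q1.2, q2⟩)
    (by
      intro t ht
      by_cases h : t + 2 ≤ k
      · rw [jn_le (by omega), jn_le (by omega), jn_le (by omega)]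
        obtain ⟨q1, q2⟩ := hu5 t (by omega)
        exact ⟨pag_arr hP hN q1.1, pag_arr hP hN q1.2⟩
      by_cases h2 : t + 1 = k
      · rw [jn_le (by omega), jn_le (by omega), jn_gt (s := 0) (by omega)]
        obtain ⟨q1, q2⟩ := hu5 t (by omega)
        rw [show t + 2 = k + 1 by omega, hu3] at q1
        exact ⟨pag_arr hP hN q1.1, pag_arr hP hN q1.2⟩
      by_cases h3 : t = k
      · subst h3
        rw [jn_le (by omega), jn_gt (s := 0) (by omega), jn_gt (s := 1) (by omega)]
        exact ⟨pag_arr hP hN hu6, hN1⟩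
      · obtain ⟨q1, q2⟩ := hp (t - k - 1) (by omega)
        rw [jn_gt (s := t - k - 1) (by omega), jn_gt (s := t - k - 1 + 1) (by omega),
          jn_gt (s := t - k - 1 + 2) (by omega)]
        exact (hg _ (by omega)).1 q1.2)
    (by
      rw [jn_gt (s := j + 1) (by omega)]
      exact wk.1 (j+1) (by omega))
  obtain ⟨k1, k2⟩ := key
  rw [jn_gt (s := j) (by omega), jn_gt (s := j+1) (by omega)] at k1
  have k3 := k2 (k + j) (by omega)
  rw [jn_gt (s := j) (by omega)] at k3
  refine gd_of_left (pag_mag hP hN).1 ((hA _ _).1 (wk.1 j (by omega)))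
    ((hA _ _).1 (wk.1 (j+1) (by omega))) k1 ?_ k3
  by_cases hj0 : j = 0
  · subst hj0; exact pag_dir hP c.hM hb.1
  · obtain ⟨i, rfl⟩ := Nat.exists_eq_succ_of_ne_zero hj0
    exact (hp i (by omega)).2

theorem Core.gd_L (c : Core P cls X Y Z M w n) {N : PMG V} (hN : N ∈ cls) {j l : ℕ}
    (hj : j + 2 ≤ n)
    (hT : TL P M X Y Z w j l) (hg : ∀ t, l ≤ t → t < j → Gd M N w t) : Gd M N w j := by
  obtain ⟨h1, h2, h3⟩ := hT
  have wk := c.gw.wk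
  have ha := c.anc
  have hP := c.s.hP
  have hA := pag_adj2 hP c.hM hN
  rcases h3 with ⟨h3, h4⟩ | ⟨rfl, hb⟩
  · obtain ⟨m, rfl⟩ : ∃ m, j = l + m := ⟨j - l, by omega⟩
    obtain ⟨k1, k2⟩ := discT (pag_mag hP c.hM) (pag_mag hP hN) (pag_equiv hP c.hM hN)
      hA (u := fun t => w (l + t)) (m := m) (c := w (l + m + 2))
      (c.inj l (l+m+2) (by omega) (by omega)) h3
      (fun t ht => wk.1 (l + t) (by omega))
      (fun t ht => ⟨(h2 (l + t) (by omega) (by omega)).1.2, (h2 (l + t) (by omega) (by omega)).2⟩)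
      (fun t ht => (hg (l + t) (by omega) (by omega)).1 (h2 (l + t) (by omega) (by omega)).1.2)
      (wk.1 (l + m + 1) (by omega))
    obtain ⟨i, rfl⟩ : ∃ i, m = i + 1 := ⟨m - 1, by omega⟩
    exact gd_of_left (pag_mag hP hN).1 ((hA _ _).1 (wk.1 _ (by omega)))
      ((hA _ _).1 (wk.1 _ (by omega))) k1 (h2 (l + i) (by omega) (by omega)).2 (k2 i (by omega))
  · by_cases hj0 : j = 0
    · subst hj0
      have hx := c.gw.h0
      have hBX : w 1 ∉ X := c.gw.px 1 le_rfl (by omega)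
      have hE0 : PE P (w 0) (w 1) → ¬ P.Arr (w 2) (w 1) → Bd P X Y (w 0) (w 1) := by
        intro q1 q2
        exact c.s.bd hx q1 (ey_cons hBX ⟨(pag_adj hP c.hM _ _).2 (wk.1 1 (by omega)), q2⟩ hb.2)
      have hMd := pag_dir hP c.hM hb.1
      have hNd := pag_dir hP hN hb.1
      have hN' := (pag_mag hP hN).1
      by_cases hM1 : M.Arr (w 1) (w 0)
      · by_cases hN1 : N.Arr (w 1) (w 0)
        · exact c.disc_vis hN hj (fun t ht => by omega) hb (fun t ht => by omega) hM1 hN1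
        · have hpe : PE P (w 0) (w 1) := pe_mk hP hN ((hA _ _).1 (wk.1 0 (by omega))) hN1
          have hPC : P.Arr (w 2) (w 1) := by
            by_contra h
            exact (pag_dir hP c.hM (hE0 hpe h).1).narr hM1
          have hNB := dir_of_narr hN'.1 (adj_symm ((hA _ _).1 (wk.1 0 (by omega)))) hN1
          refine ⟨fun _ => ⟨hNB.arr, pag_arr hP hN hPC⟩, fun h => ?_⟩
          exfalso
          exact (dir_of_ncol ha (wk.1 0 (by omega)) (wk.1 1 (by omega)) h hMd).narr
            (pag_arr hP c.hM hPC)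
      · have hpe : PE P (w 0) (w 1) := pe_mk hP c.hM (wk.1 0 (by omega)) hM1
        have hPC : P.Arr (w 2) (w 1) := by
          by_contra h
          exact c.gw.nb (hE0 hpe h)
        have hMB := dir_of_narr ha.1 (adj_symm (wk.1 0 (by omega))) hM1
        refine ⟨fun _ => ⟨?_, pag_arr hP hN hPC⟩, fun h => ?_⟩
        · by_contra h
          have := dir_of_narr hN'.1 ((hA _ _).1 (wk.1 0 (by omega))) h
          exact kk hN' (pag_arr hP hN hPC) (this.an.trans hNd.an)
        · exact absurd ⟨hMB.arr, pag_arr hP c.hM hPC⟩ h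
    · have hw1 : ∀ N' ∈ cls, N'.Arr (w 1) (w 0) := by
        intro N' hN'
        by_contra h
        have q1 := pe_mk hP hN' ((pag_adj2 hP c.hM hN' _ _).1 (wk.1 0 (by omega))) h
        obtain ⟨q2, q3⟩ := h2 0 le_rfl (by omega)
        exact c.s.forb c.gw.h0 q1 (ey_cons (c.gw.px 1 le_rfl (by omega)) (pe_of_dir hP c.hM q3) hb.2)
          q2.1 Relation.ReflTransGen.refl
      exact c.disc_vis hN hj (fun t ht => h2 t (by omega) ht) hb (fun t ht => hg t (by omega) ht)
        (hw1 M c.hM) (hw1 N hN)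

/-- No two triples can depend on each other. -/
theorem Core.no_cycle (c : Core P cls X Y Z M w n) {i j l r : ℕ} (hij : i < j) (hj : j + 2 ≤ n)
    (hL : TL P M X Y Z w j l) (hR : TR M Z w n i r) (hli : l ≤ i) (hjr : j + 1 < r) : False := by
  obtain ⟨h1, h2, h3⟩ := hL
  obtain ⟨g1, g2, g3, g4⟩ := hR
  have ha := c.anc
  have wk := c.gw.wk
  obtain ⟨⟨_, cj⟩, dj⟩ := g3 j (by omega) hjr
  obtain ⟨⟨_, ci⟩, di⟩ := h2 i hli hij
  have hnd : ¬ M.DirEdge (w i) (w (j+2)) := fun h => kk ha cj.2 (dj.an.trans h.an)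
  by_cases hl : l < i
  · obtain ⟨k, rfl⟩ : ∃ k, i = k + 1 := ⟨i - 1, by omega⟩
    exact hnd (h2 k (by omega) (by omega)).2
  have hl : l = i := by omega
  subst hl
  rcases h3 with ⟨h3, h4⟩ | ⟨rfl, hb⟩
  · have h0 : w l ≠ w (j+2) := c.inj l (j+2) (by omega) hj
    obtain ⟨S, hS1, hS2, hS⟩ := (pag_mag c.s.hP c.hM).2 _ _ h0 h3
    obtain ⟨m, rfl⟩ : ∃ m, j = l + m := ⟨j - l, by omega⟩
    have hadj : ∀ t, t ≤ m → M.Adj (w (l + t)) (w (l + (t + 1))) :=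
      fun t ht => wk.1 (l + t) (by omega)
    have hmem := discPar ha (u := fun t => w (l + t)) (m := m) h0 hS hadj
      (fun t ht => ⟨(h2 (l + t) (by omega) (by omega)).1.2, (h2 (l + t) (by omega) (by omega)).2⟩)
    have q1 := (discS ha (u := fun t => w (l + t)) (m := m) h0 hS hadj
      (fun t ht => ⟨(h2 (l + t) (by omega) (by omega)).1.2, hmem t ht⟩)
      (wk.1 (l + m + 1) (by omega))).1 cj
    have q2 := discS ha (u := fun t => if t = 0 then w l else w (l + m + 1)) (m := 0)
      (c := w (l + m + 2)) (by simpa using h0) (by simpa using hS)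
      (by intro t ht; simp [show t = 0 by omega]; exact adj_symm dj.adj)
      (by intro t ht; omega) (by simpa using wk.1 (l + m + 1) (by omega))
    simp only [if_true] at q2
    exact dj.narr (q2.2 q1).1
  · exact hnd (pag_dir c.s.hP c.hM hb.1)

theorem Core.gd (c : Core P cls X Y Z M w n) {N : PMG V} (hN : N ∈ cls) :
    ∀ j, j + 2 ≤ n → Gd M N w j := by
  -- no bad index of left type
  have hleft : ∀ j, j + 2 ≤ n → ∀ l, TL P M X Y Z w j l → Gd M N w j := by
    intro j
    induction j using Nat.strong_induction_on with
    | _ j ih =>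
      intro hj l hl
      obtain ⟨i, hi1, hi2, hi3⟩ := maxL (fun t => Gd M N w t) j
      by_cases hil : i ≤ l
      · exact c.gd_L hN hj hl fun t h1 h2 => hi2 t (by omega) h2
      · obtain ⟨k, rfl⟩ : ∃ k, i = k + 1 := ⟨i - 1, by omega⟩
        have hbad := hi3 k rfl
        exfalso
        by_cases hs : M.Adj (w k) (w (k+2))
        · rcases c.classify (by omega) hs with ⟨l', hl'⟩ | ⟨r, hr⟩
          · exact hbad (ih k (by omega) (by omega) l' hl')
          · by_cases hjr : j + 1 < r
            · exact c.no_cycle (by omega) hj hl hr (by omega) hjr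
            · exact hbad (c.gd_R hN hr fun t h1 h2 => hi2 t (by omega) (by omega))
        · exact hbad (c.gd_unsh hN (by omega) hs)
  have hall : ∀ d j, j + 2 + d = n → Gd M N w j := by
    intro d
    induction d using Nat.strong_induction_on with
    | _ d ih =>
      intro j hj
      by_cases hs : M.Adj (w j) (w (j+2))
      · rcases c.classify (by omega) hs with ⟨l', hl'⟩ | ⟨r, hr⟩
        · exact hleft j (by omega) l' hl'
        · refine c.gd_R hN hr fun t h1 h2 => ih (n - (t + 2)) ?_ t ?_
          · have := hr.2.1; omega
          · have := hr.2.1; omega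
      · exact c.gd_unsh hN (by omega) hs
  intro j hj
  exact hall (n - (j+2)) j (by omega)

end PMG


namespace PMG
variable {V : Type}

/-! ### Distance from `Z` -/

def DW (M : PMG V) (Z : Finset V) : ℕ → V → Prop
  | 0, v => v ∈ Z
  | k+1, v => ∃ r, M.DirEdge v r ∧ DW M Z k r

noncomputable def dst (M : PMG V) (Z : Finset V) (v : V) : ℕ := sInf {k | DW M Z k v}

theorem ans_iff {M : PMG V} {Z : Finset V} {v : V} : AnS M Z v ↔ ∃ k, DW M Z k v := by
  constructor
  · rintro ⟨z, hz, h⟩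
    induction h using Relation.ReflTransGen.head_induction_on with
    | refl => exact ⟨0, hz⟩
    | head h1 _ ih =>
      obtain ⟨k, hk⟩ := ih
      exact ⟨k+1, _, h1, hk⟩
  · rintro ⟨k, hk⟩
    induction k generalizing v with
    | zero => exact ⟨v, hk, Relation.ReflTransGen.refl⟩
    | succ k ih =>
      obtain ⟨r, h1, h2⟩ := hk
      exact AnS.of_dir h1.an (ih h2)

theorem dst_spec {M : PMG V} {Z : Finset V} {v : V} (h : AnS M Z v) : DW M Z (dst M Z v) v :=
  Nat.sInf_mem (s := {k | DW M Z k v}) (ans_iff.1 h)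

theorem dst_le {M : PMG V} {Z : Finset V} {v : V} {k : ℕ} (h : DW M Z k v) : dst M Z v ≤ k :=
  Nat.sInf_le h

theorem dst_edge {M : PMG V} {Z : Finset V} {a c : V} (h : M.DirEdge a c) (h2 : AnS M Z c) :
    dst M Z a ≤ dst M Z c + 1 :=
  dst_le ⟨c, h, dst_spec h2⟩

theorem dst_step {M : PMG V} {Z : Finset V} {v : V} (h : AnS M Z v) (hv : v ∉ Z) :
    ∃ r, M.DirEdge v r ∧ AnS M Z r ∧ dst M Z r + 1 = dst M Z v := by
  have h1 := dst_spec h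
  cases hk : dst M Z v with
  | zero => rw [hk] at h1; exact absurd h1 hv
  | succ k =>
    rw [hk] at h1
    obtain ⟨r, h2, h3⟩ := h1
    have h4 : AnS M Z r := ans_iff.2 ⟨k, h3⟩
    have h5 := dst_edge h2 h4
    have h6 := dst_le h3
    exact ⟨r, h2, h4, by omega⟩

noncomputable def meas (M : PMG V) (Z : Finset V) (w : ℕ → V) (n : ℕ) : ℕ :=
  ∑ j ∈ Finset.range (n - 1), if Col M (w j) (w (j+1)) (w (j+2)) then dst M Z (w (j+1)) else 0

structure Core2 (P : PMG V) (cls : Set (PMG V)) (X Y Z : Finset V) (M : PMG V) (w : ℕ → V) (n : ℕ) :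
    Prop where
  c : Core P cls X Y Z M w n
  hmin2 : ∀ w', GW P M X Y Z w' n → meas M Z w n ≤ meas M Z w' n

variable {P : PMG V} {cls : Set (PMG V)} {X Y Z : Finset V} {M : PMG V} {w : ℕ → V} {n : ℕ}

theorem exists_core2 (s : Setup P cls X Y Z) (hM : M ∈ cls) (h : GW P M X Y Z w n) :
    ∃ w n, Core2 P cls X Y Z M w n := by
  have h1 : ∃ n, ∃ w, GW P M X Y Z w n := ⟨n, w, h⟩
  have h2 : ∃ m, ∃ w, GW P M X Y Z w (Nat.find h1) ∧ meas M Z w (Nat.find h1) = m := by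
    obtain ⟨w', hw'⟩ := Nat.find_spec h1
    exact ⟨_, w', hw', rfl⟩
  obtain ⟨w', hw', he⟩ := Nat.find_spec h2
  refine ⟨w', Nat.find h1, ⟨s, hM, hw', fun v m hv => Nat.find_min' h1 ⟨v, hv⟩⟩, ?_⟩
  intro v hv
  rw [he]
  exact Nat.find_min' h2 ⟨v, hv, rfl⟩

theorem Core2.step (c2 : Core2 P cls X Y Z M w n) {i : ℕ} (hi : i + 2 ≤ n)
    (hcol : Col M (w i) (w (i+1)) (w (i+2))) {R : V} (hR : M.DirEdge (w (i+1)) R)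
    (hA : AnS M Z R) (hd : dst M Z R + 1 = dst M Z (w (i+1))) {N : PMG V} (hN : N ∈ cls) :
    N.DirEdge (w (i+1)) R := by
  have c := c2.c
  have ha := c.anc
  have wk := c.gw.wk
  have hP := c.s.hP
  have hA2 := pag_adj2 hP c.hM hN
  have hNa := (pag_mag hP hN).1
  have hNc := (c.gd hN i hi).1 hcol
  have hNadj := (hA2 _ _).1 hR.adj
  obtain ⟨l, hl1, hl2, hl3⟩ := maxL (fun t => CZ M Z w t ∧ M.DirEdge (w (t+1)) R) i
  obtain ⟨r, hr1, hr2, hr3, hr4⟩ := minR (fun t => CZ M Z w t ∧ M.DirEdge (w (t+1)) R)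
    (i+1) n (by omega)
  have hL : ∀ t, l ≤ t → t ≤ i → Col M (w t) (w (t+1)) (w (t+2)) ∧ M.DirEdge (w (t+1)) R := by
    intro t h1 h2
    by_cases h : t = i
    · subst h; exact ⟨hcol, hR⟩
    · have := hl2 t h1 (by omega)
      exact ⟨this.1.2, this.2⟩
  have hRR : ∀ t, i ≤ t → t + 1 < r → Col M (w t) (w (t+1)) (w (t+2)) ∧ M.DirEdge (w (t+1)) R := by
    intro t h1 h2
    by_cases h : t = i
    · subst h; exact ⟨hcol, hR⟩
    · have := hr3 t (by omega) h2
      exact ⟨this.1.2, this.2⟩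
  obtain ⟨cl, dl⟩ := hL l le_rfl hl1
  by_cases hal : M.Adj (w l) R
  swap
  · obtain ⟨m, rfl⟩ : ∃ m, i = l + m := ⟨i - l, by omega⟩
    obtain ⟨k1, _⟩ := discT (pag_mag hP c.hM) (pag_mag hP hN) (pag_equiv hP c.hM hN)
      hA2 (u := fun t => w (l + t)) (m := m) (c := R)
      (by
        intro he
        exact dl.narr (by rw [← show w l = R from he]; exact cl.1)) hal
      (fun t ht => wk.1 (l + t) (by omega))
      (fun t ht => hL (l + t) (by omega) (by omega))
      (fun t ht => (c.gd hN (l + t) (by omega)).1 (hL (l + t) (by omega) (by omega)).1)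
      hR.adj
    refine dir_of_narr hNa.1 (adj_symm hNadj) fun h => ?_
    exact hR.narr (k1.2 ⟨hNc.1, h⟩).2
  obtain ⟨m, rfl⟩ : ∃ m, r = i + 2 + m := ⟨r - (i+2), by omega⟩
  obtain ⟨cr, dr⟩ := hRR (i + m) (by omega) (by omega)
  by_cases har : M.Adj (w (i+2+m)) R
  swap
  · obtain ⟨k1, _⟩ := discT (pag_mag hP c.hM) (pag_mag hP hN) (pag_equiv hP c.hM hN)
      hA2 (u := fun t => w (i + 2 + m - t)) (m := m) (c := R)
      (by
        intro he
        refine dr.narr ?_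
        rw [← show w (i+2+m) = R from he, show i + 2 + m = i + m + 2 by omega]; exact cr.2)
      (by simpa using har)
      (by
        intro t ht
        have := wk.1 (i + 2 + m - (t+1)) (by omega)
        rw [show i + 2 + m - (t+1) + 1 = i + 2 + m - t by omega] at this
        exact adj_symm this)
      (by
        intro t ht
        have := hRR (i + 2 + m - (t+2)) (by omega) (by omega)
        rw [show i + 2 + m - (t+2) + 1 = i + 2 + m - (t+1) by omega,
          show i + 2 + m - (t+2) + 2 = i + 2 + m - t by omega] at this
        exact ⟨this.1.symm, this.2⟩)
      (by
        intro t ht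
        have := (c.gd hN (i + 2 + m - (t+2)) (by omega)).1
          (hRR (i + 2 + m - (t+2)) (by omega) (by omega)).1
        rw [show i + 2 + m - (t+2) + 1 = i + 2 + m - (t+1) by omega,
          show i + 2 + m - (t+2) + 2 = i + 2 + m - t by omega] at this
        exact this.symm)
      (by
        show M.Adj (w (i + 2 + m - (m+1))) R
        rw [show i + 2 + m - (m+1) = i + 1 by omega]
        exact hR.adj)
    simp only [show i + 2 + m - (m+1) = i + 1 by omega, show i + 2 + m - m = i + 2 by omega] at k1
    refine dir_of_narr hNa.1 (adj_symm hNadj) fun h => ?_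
    exact hR.narr (k1.2 ⟨hNc.2, h⟩).2
  exfalso
  have arl : M.Arr (w l) R := arr_trans ha cl.1 dl.an hal
  have arr : M.Arr (w (i+2+m)) R := by
    refine arr_trans ha ?_ dr.an har
    rw [show i + 2 + m = i + m + 2 by omega]; exact cr.2
  have H1l : M.Arr R (w l) → M.Arr (w (l+1)) (w l) := by
    intro h
    by_contra h2
    exact kk ha h ((dir_of_narr ha.1 (adj_symm (wk.1 l (by omega))) h2).an.trans dl.an)
  have H1r : M.Arr R (w (i+2+m)) → M.Arr (w (i+m+1)) (w (i+2+m)) := by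
    intro h
    by_contra h2
    have := wk.1 (i+m+1) (by omega)
    rw [show i + m + 1 + 1 = i + 2 + m by omega] at this
    exact kk ha h ((dir_of_narr ha.1 this h2).an.trans dr.an)
  have okl : ∀ k, l = k + 1 → Ok M Z (w k) (w (k+1)) R := by
    intro k hk
    subst hk
    refine ok_joint ha.1 (wk.2 k (by omega)) hal (fun h => Or.inl (H1l h)) ?_
    intro h1 h2 h3 h4
    exact hl3 k rfl ⟨⟨h1, h2, h3⟩, h4⟩
  have okr : i + 2 + m < n → Ok M Z R (w (i+2+m)) (w (i+2+m+1)) := by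
    intro hlt
    have e : i + m + 1 + 1 = i + 2 + m := by omega
    have e2 : i + m + 1 + 2 = i + 2 + m + 1 := by omega
    have o := (wk.2 (i+m+1) (by omega)).symm
    rw [e, e2] at o
    refine (ok_joint ha.1 o har (fun h => Or.inl (H1r h)) ?_).symm
    intro h1 h2 h3 h4
    apply hr4 hlt
    rw [CZ, show i + 2 + m - 1 + 1 = i + 2 + m by omega,
      show i + 2 + m - 1 + 2 = i + 2 + m + 1 by omega, show i + 2 + m - 1 = i + m + 1 by omega]
    exact ⟨⟨h1, h3, h2⟩, h4⟩
  set r := i + 2 + m with hr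
  set v : ℕ → V := jn 0 (fun _ => R) (fun t => w (r + t)) with hv
  have v0 : v 0 = R := jn_le le_rfl
  have vs : ∀ t, v (t+1) = w (r + t) := fun t => jn_gt (s := t) (by omega)
  have hvw : Wk M Z v (0 + (n - r) + 1) := by
    refine (wk_zero (fun _ => R)).join wk.suf (adj_symm har) (by intro k hk; omega) ?_
    intro h
    exact okr (by omega)
  by_cases hRX : R ∈ X
  · have := c.hmin v (0 + (n - r) + 1) ⟨hvw, by rw [v0]; exact hRX, ?_, ?_, ?_⟩
    · omega
    · rw [vs, show r + (0 + (n - r)) = n by omega]; exact c.gw.hn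
    · intro t h1 h2
      obtain ⟨t, rfl⟩ : ∃ k, t = k + 1 := ⟨t - 1, by omega⟩
      rw [vs]; exact c.gw.px _ (by omega) (by omega)
    · rw [v0, vs 0]
      intro hb
      exact (pag_dir hP c.hM hb.1).narr arr
  have hww : Wk M Z (jn l w v) (l + (0 + (n - r) + 1) + 1) := by
    refine (wk.pre (by omega)).join hvw (by rw [v0]; exact hal) ?_ ?_
    · rw [v0]; exact okl
    · intro _
      rw [v0, vs 0]
      exact ⟨fun _ _ => hA, fun _ => ⟨arl, arr⟩⟩
  have hgw : GW P M X Y Z (jn l w v) (l + (0 + (n - r) + 1) + 1) := by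
    refine ⟨hww, ?_, ?_, ?_, ?_⟩
    · rw [jn_le (by omega)]; exact c.gw.h0
    · rw [jn_gt (s := 0 + (n - r) + 1) (by omega), vs, show r + (0 + (n - r)) = n by omega]
      exact c.gw.hn
    · intro t h1 h2
      by_cases h : t ≤ l
      · rw [jn_le h]; exact c.gw.px t h1 (by omega)
      by_cases h3 : t = l + 1
      · rw [jn_gt (s := 0) (by omega), v0]; exact hRX
      · rw [jn_gt (s := t - l - 2 + 1) (by omega), vs]; exact c.gw.px _ (by omega) (by omega)
    · rw [jn_le (by omega)]
      by_cases h : l = 0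
      · rw [jn_gt (s := 0) (by omega), v0]
        intro hb
        obtain ⟨z, hz, hz2⟩ := hA
        exact c.s.forb c.gw.h0 ⟨hb.1.adj, hb.1.narr⟩ hb.2 hz (pe_of_an hP c.hM hz2)
      · rw [jn_le (by omega)]; exact c.gw.nb
  have hle := c.hmin _ _ hgw
  have hm : m = 0 := by omega
  subst hm
  have hli : l = i := by omega
  subst hli
  have hlen : l + (0 + (n - r) + 1) + 1 = n := by omega
  rw [hlen] at hgw
  have hms := c2.hmin2 _ hgw
  have e1 : jn l w v (l+1) = R := by rw [jn_gt (s := 0) (by omega), v0]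
  have e2 : ∀ t, t ≠ l + 1 → jn l w v t = w t := by
    intro t ht
    by_cases h : t ≤ l
    · exact jn_le h
    · rw [jn_gt (s := t - l - 2 + 1) (by omega), vs, show r + (t - l - 2) = t by omega]
  have hlt : meas M Z (jn l w v) n < meas M Z w n := by
    apply Finset.sum_lt_sum
    · intro j hj
      by_cases hjl : j = l
      · subst hjl
        rw [e1, if_pos hcol]
        split_ifs <;> omega
      · rw [e2 (j+1) (by omega)]
        by_cases hcn : Col M (jn l w v j) (w (j+1)) (jn l w v (j+2))
        · rw [if_pos hcn, if_pos]
          by_cases h1 : j = l + 1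
          · subst h1
            rw [e1, e2 _ (by omega)] at hcn
            exact ⟨H1r hcn.1, hcn.2⟩
          by_cases h2 : j + 2 = l + 1
          · rw [e2 j (by omega), h2, e1] at hcn
            rw [h2]
            have h3 : l = j + 1 := by omega
            refine ⟨hcn.1, ?_⟩
            rw [← h3]
            rw [← h3] at hcn
            exact H1l hcn.2
          · rw [e2 j h1, e2 _ h2] at hcn; exact hcn
        · rw [if_neg hcn]; omega
    · refine ⟨l, by simp; omega, ?_⟩
      rw [e1, if_pos hcol]
      split_ifs <;> omega
  omega

/-! ### Descendants in `P` -/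

theorem desc_chain (s : Setup P cls X Y Z) (hM : M ∈ cls) : ∀ (k : ℕ) (a b : V), P.Arr a b →
    M.DirEdge a b → AnS M Z b → dst M Z b = k → dst M Z b + 1 = dst M Z a →
    ∃ z ∈ Z, P.An b z := by
  intro k
  induction k with
  | zero =>
    intro a b _ _ h1 h2 _
    have := dst_spec h1
    rw [h2] at this
    exact ⟨b, this, Relation.ReflTransGen.refl⟩
  | succ k ih =>
    intro a b hab hd h1 h2 h3
    by_cases hb : b ∈ Z
    · exact ⟨b, hb, Relation.ReflTransGen.refl⟩
    obtain ⟨e, he1, he2, he3⟩ := dst_step h1 hb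
    have ha := (pag_mag s.hP hM).1
    have hne : a ≠ e := by
      rintro rfl; omega
    have hna : ¬ M.Adj a e := by
      intro h
      have := dst_edge (dir_of_an ha h (hd.an.trans he1.an)) he2
      omega
    have hPd : P.DirEdge b e := by
      refine pag_dir_mk s.hP ((pag_adj s.hP hM _ _).2 he1.adj) fun N hN => ?_
      have hu := unshT (pag_mag s.hP hM) (pag_mag s.hP hN) (pag_equiv s.hP hM hN)
        (pag_adj2 s.hP hM hN) hd.adj he1.adj hne hna
      refine dir_of_narr (pag_mag s.hP hN).1.1
        (adj_symm ((pag_adj2 s.hP hM hN _ _).1 he1.adj)) fun h => ?_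
      exact he1.narr (hu.2 ⟨pag_arr s.hP hN hab, h⟩).2
    obtain ⟨z, hz, hz2⟩ := ih b e hPd.arr he1 he2 (by omega) he3
    exact ⟨z, hz, hPd.an.trans hz2⟩

theorem Core2.desc (c2 : Core2 P cls X Y Z M w n) {i : ℕ} (hi : i + 2 ≤ n)
    (hcol : Col M (w i) (w (i+1)) (w (i+2))) : ∃ z ∈ Z, P.An (w (i+1)) z := by
  have c := c2.c
  by_cases hq : w (i+1) ∈ Z
  · exact ⟨_, hq, Relation.ReflTransGen.refl⟩
  have hA := (c.gw.wk.2 i hi).1 hcol.1 hcol.2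
  obtain ⟨R, h1, h2, h3⟩ := dst_step hA hq
  have hPd : P.DirEdge (w (i+1)) R :=
    pag_dir_mk c.s.hP ((pag_adj c.s.hP c.hM _ _).2 h1.adj) fun N hN => c2.step hi hcol h1 h2 h3 hN
  obtain ⟨z, hz, hz2⟩ := desc_chain c.s c.hM _ _ _ hPd.arr h1 h2 rfl h3
  exact ⟨z, hz, hPd.an.trans hz2⟩

/-! ### The path in `P` -/

theorem mark_cases {G : PMG V} {a b : V} (h : G.Adj a b) :
    G.mark a b = some Mark.tail ∨ G.Arr a b ∨ G.mark a b = some Mark.circle := by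
  unfold Adj at h
  obtain ⟨m, hm⟩ := Option.isSome_iff_exists.1 h
  cases m <;> simp [Arr, hm]

theorem Core2.status (c2 : Core2 P cls X Y Z M w n) {i : ℕ} (hi : i + 2 ≤ n) :
    Col P (w i) (w (i+1)) (w (i+2)) ∨ P.mark (w i) (w (i+1)) = some Mark.tail ∨
      P.mark (w (i+2)) (w (i+1)) = some Mark.tail ∨
      (P.mark (w i) (w (i+1)) = some Mark.circle ∧ P.mark (w (i+2)) (w (i+1)) = some Mark.circle ∧
        ¬ P.Adj (w i) (w (i+2))) := by
  have c := c2.c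
  have hP := c.s.hP
  have wk := c.gw.wk
  have p1 := (pag_adj hP c.hM _ _).2 (wk.1 i (by omega))
  have p2 := adj_symm ((pag_adj hP c.hM _ _).2 (wk.1 (i+1) (by omega)))
  by_cases hcol : Col M (w i) (w (i+1)) (w (i+2))
  · left
    exact ⟨pag_arr_mk hP p1 fun N hN => ((c.gd hN i hi).1 hcol).1,
      pag_arr_mk hP p2 fun N hN => ((c.gd hN i hi).1 hcol).2⟩
  right
  by_cases hs : M.Adj (w i) (w (i+2))
  · have hdir : M.DirEdge (w i) (w (i+2)) ∨ M.DirEdge (w (i+2)) (w i) := by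
      rcases c.classify hi hs with ⟨l, h1, h2, h3⟩ | ⟨r, h1, h2, h3, h4⟩
      · left
        rcases h3 with ⟨h3, h4⟩ | ⟨rfl, hb⟩
        · obtain ⟨k, rfl⟩ : ∃ k, i = k + 1 := ⟨i - 1, by omega⟩
          exact (h2 k (by omega) (by omega)).2
        · by_cases h0 : i = 0
          · subst h0; exact pag_dir hP c.hM hb.1
          · obtain ⟨k, rfl⟩ : ∃ k, i = k + 1 := ⟨i - 1, by omega⟩
            exact (h2 k (by omega) (by omega)).2
      · right
        exact (h3 (i+1) le_rfl (by omega)).2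
    rcases hdir with h | h
    · right; left
      exact pag_tail_mk hP p2 fun N hN => (((c.gd hN i hi).2 hcol).2.1 h).2
    · left
      exact pag_tail_mk hP p1 fun N hN => (((c.gd hN i hi).2 hcol).2.2 h).2
  · have hps : ¬ P.Adj (w i) (w (i+2)) := fun h => hs ((pag_adj hP c.hM _ _).1 h)
    rcases mark_cases p1 with h | h | h
    · exact Or.inl h
    · right; left
      refine pag_tail_mk hP p2 fun N hN => ?_
      exact (dir_of_narr (pag_mag hP hN).1.1 ((pag_adj hP hN _ _).1 p2)
        fun h2 => ((c.gd hN i hi).2 hcol).1 ⟨pag_arr hP hN h, h2⟩).2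
    · rcases mark_cases p2 with g | g | g
      · exact Or.inr (Or.inl g)
      · left
        refine pag_tail_mk hP p1 fun N hN => ?_
        exact (dir_of_narr (pag_mag hP hN).1.1 ((pag_adj hP hN _ _).1 p1)
          fun h2 => ((c.gd hN i hi).2 hcol).1 ⟨h2, pag_arr hP hN g⟩).2
      · exact Or.inr (Or.inr ⟨h, g, hps⟩)

theorem Core2.final (c2 : Core2 P cls X Y Z M w n) : ∃ p, ProperPath P X Y p ∧ DefStatus P p ∧
    ¬ PossDirAlong P p ∧ MConn P Z p := by
  have c := c2.c
  have hP := c.s.hP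
  have wk := c.gw.wk
  have hpadj : ∀ i, i < n → P.Adj (w i) (w (i+1)) := fun i hi => (pag_adj hP c.hM _ _).2 (wk.1 i hi)
  have hn1 : 1 ≤ n := by
    by_contra h
    have h0 : n = 0 := by omega
    subst h0
    exact Finset.disjoint_left.1 c.s.hXY c.gw.h0 c.gw.hn
  have hget : ∀ i, i ≤ n → (pl w n)[i]? = some (w i) := fun i hi => by rw [pl_get, if_pos hi]
  have hpp : ProperPath P X Y (pl w n) := by
    refine ⟨pl_path hpadj c.inj, ⟨_, c.gw.h0, pl_head w n⟩, ⟨_, c.gw.hn, pl_last w n⟩, ?_⟩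
    intro e he
    obtain ⟨t, ht⟩ := List.mem_iff_getElem?.1 he
    rw [List.getElem?_tail] at ht
    obtain ⟨h1, rfl⟩ := pl_get_some ht
    exact c.gw.px _ (by omega) h1
  have hds : DefStatus P (pl w n) := by
    intro i hi
    rw [pl_length] at hi
    rcases c2.status (i := i) (by omega) with h | h
    · exact Or.inl (pl_col_mk (by omega) h.1 h.2)
    · exact Or.inr ⟨_, _, _, hget i (by omega), hget (i+1) (by omega), hget (i+2) (by omega), h⟩
  refine ⟨pl w n, hpp, hds, ?_, hds, ?_, ?_⟩
  · intro hpd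
    have hpe : ∀ i, i < n → PE P (w i) (w (i+1)) := fun i hi =>
      ⟨hpadj i hi, hpd i _ _ (hget i (by omega)) (hget (i+1) (by omega))⟩
    have hey : ∀ d t, t + d = n → 1 ≤ t → EY P X Y (w t) := by
      intro d
      induction d with
      | zero =>
        intro t h1 h2
        have : t = n := by omega
        subst this
        exact ⟨c.gw.px _ h2 le_rfl, _, c.gw.hn, Relation.ReflTransGen.refl⟩
      | succ d ih =>
        intro t h1 h2
        exact ey_cons (c.gw.px _ h2 (by omega)) (hpe t (by omega)) (ih (t+1) (by omega) (by omega))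
    exact c.gw.nb (c.s.bd c.gw.h0 (hpe 0 (by omega)) (hey (n-1) 1 (by omega) le_rfl))
  · rintro i b hb ⟨a', b', c', h1, h2, h3, h4⟩ hbz
    obtain ⟨g1, rfl⟩ := pl_get_some hb
    obtain ⟨g2, rfl⟩ := pl_get_some h1
    obtain ⟨g3, rfl⟩ := pl_get_some h2
    obtain ⟨g4, rfl⟩ := pl_get_some h3
    have hcol := (wk.2 i (by omega)).2 hbz
    have q1 : P.Arr (w i) (w (i+1)) := pag_arr_mk hP (hpadj i (by omega))
      fun N hN => ((c.gd hN i (by omega)).1 hcol).1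
    have q2 : P.Arr (w (i+2)) (w (i+1)) := pag_arr_mk hP (adj_symm (hpadj (i+1) (by omega)))
      fun N hN => ((c.gd hN i (by omega)).1 hcol).2
    unfold Arr at q1 q2
    rw [q1, q2] at h4
    simp at h4
  · intro i b hb hc
    obtain ⟨g1, rfl⟩ := pl_get_some hb
    obtain ⟨h1, h2, h3⟩ := pl_col hc
    obtain ⟨z, hz, hz2⟩ := c2.desc h1 ⟨pag_arr hP c.hM h2, pag_arr hP c.hM h3⟩
    exact ⟨z, hz, desc_iff.2 hz2⟩

theorem exists_gw (s : Setup P cls X Y Z) (hM : M ∈ cls) {p : List V} (hp : ProperPath M X Y p)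
    (hpd : ¬ PossDirAlong M p) (hc : MConn M Z p) : ∃ w n, GW P M X Y Z w n := by
  obtain ⟨⟨hne, hnd, hch⟩, ⟨x, hx, hh⟩, ⟨y, hy, hl⟩, hpx⟩ := hp
  have hlen : 0 < p.length := List.length_pos_iff.2 hne
  have ha := (pag_mag s.hP hM).1
  set w : ℕ → V := fun t => p.getD t x with hw
  have hget : ∀ t, t < p.length → p[t]? = some (w t) := by
    intro t ht
    simp [hw, List.getD, ht]
  have hadj : ∀ t, t + 1 < p.length → M.Adj (w t) (w (t+1)) := fun t ht =>
    succ_of_chain hch t _ _ (hget t (by omega)) (hget (t+1) (by omega))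
  have wk : Wk M Z w (p.length - 1) := by
    refine ⟨fun i hi => hadj i (by omega), fun i hi => ⟨?_, ?_⟩⟩
    · intro h1 h2
      obtain ⟨z, hz, hz2⟩ := hc.2.2 i _ (hget (i+1) (by omega))
        ⟨_, _, _, hget i (by omega), hget (i+1) (by omega), hget (i+2) (by omega), h1, h2⟩
      exact ⟨z, hz, desc_iff.1 hz2⟩
    · intro hz
      have hnn := fun h => hc.2.1 i _ (hget (i+1) (by omega))
        ⟨_, _, _, hget i (by omega), hget (i+1) (by omega), hget (i+2) (by omega), h⟩ hz
      constructor
      · by_contra h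
        exact hnn (Or.inl (dir_of_narr ha.1 (hadj i (by omega)) h).2)
      · by_contra h
        exact hnn (Or.inr (Or.inl (dir_of_narr ha.1 (adj_symm (hadj (i+1) (by omega))) h).2))
  have h0 : w 0 = x := by
    have := hget 0 hlen
    rw [← List.head?_eq_getElem?, hh] at this
    simpa using this.symm
  have hn : w (p.length - 1) = y := by
    have := hget (p.length - 1) (by omega)
    rw [← List.getLast?_eq_getElem?, hl] at this
    simpa using this.symm
  refine ⟨w, p.length - 1, wk, h0 ▸ hx, hn ▸ hy, ?_, ?_⟩
  · intro t h1 h2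
    apply hpx
    refine List.mem_iff_getElem?.2 ⟨t - 1, ?_⟩
    rw [List.getElem?_tail, show t - 1 + 1 = t by omega]
    exact hget t (by omega)
  · intro hb
    apply hpd
    have hb1 := pag_dir s.hP hM hb.1
    have hno : ¬ AnS M Z (w 1) := by
      rintro ⟨z, hz, hz2⟩
      exact s.forb (h0 ▸ hx) ⟨hb.1.adj, hb.1.narr⟩ hb.2 hz (pe_of_an s.hP hM hz2)
    have key : ∀ d, d + 1 < p.length → M.DirEdge (w d) (w (d+1)) ∧ M.An (w 1) (w (d+1)) := by
      intro d
      induction d with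
      | zero => intro _; exact ⟨hb1, Relation.ReflTransGen.refl⟩
      | succ d ih =>
        intro hd
        obtain ⟨i1, i2⟩ := ih (by omega)
        have : M.DirEdge (w (d+1)) (w (d+2)) := by
          refine dir_of_narr ha.1 (adj_symm (hadj (d+1) hd)) fun h => ?_
          exact hno (AnS.of_dir i2 ((wk.2 d (by omega)).1 i1.arr h))
        exact ⟨this, i2.trans this.an⟩
    intro i a b h1 h2
    have hi : i + 1 < p.length := (List.getElem?_eq_some_iff.1 h2).1
    rw [hget i (by omega)] at h1
    rw [hget (i+1) hi] at h2
    simp only [Option.some.injEq] at h1 h2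
    subst h1; subst h2
    exact (key i hi).1.narr

theorem back (hP : IsPAGOf P cls) (hM : M ∈ cls) {p : List V} (hp : ProperPath P X Y p)
    (hds : DefStatus P p) (hpd : ¬ PossDirAlong P p) (hc : MConn P Z p) :
    ProperPath M X Y p ∧ ¬ PossDirAlong M p ∧ MConn M Z p := by
  obtain ⟨⟨hne, hnd, hch⟩, hh, hl, hpx⟩ := hp
  have hs := succ_of_chain hch
  have ha := (pag_mag hP hM).1
  have hsM : ∀ i c d, p[i]? = some c → p[i+1]? = some d → M.Adj c d :=
    fun i c d h1 h2 => (pag_adj hP hM _ _).1 (hs i c d h1 h2)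
  -- statuses agree
  have hnc : ∀ i, DefNonColliderAt P p i → ¬ ColliderAt M p i := by
    rintro i ⟨a, b, e, h1, h2, h3, h4⟩ ⟨a', b', e', g1, g2, g3, g4, g5⟩
    rw [h1] at g1; rw [h2] at g2; rw [h3] at g3
    simp only [Option.some.injEq] at g1 g2 g3
    subst g1; subst g2; subst g3
    rcases h4 with h | h | ⟨h, h', h''⟩
    · have := pag_tail hP hM h
      rw [g4] at this; simp at this
    · have := pag_tail hP hM h
      rw [g5] at this; simp at this
    · have hne : a ≠ e := by
        rintro rfl
        have hi : i < p.length := (List.getElem?_eq_some_iff.1 h1).1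
        have := (List.getElem?_inj hi hnd).1 (h1.trans h3.symm)
        omega
      have hu : P.Arr a b := by
        refine pag_arr_mk hP (hs i a b h1 h2) fun N hN => ?_
        exact ((unshT (pag_mag hP hM) (pag_mag hP hN) (pag_equiv hP hM hN) (pag_adj2 hP hM hN)
          (hsM i a b h1 h2) (hsM (i+1) b e h2 h3) hne
          (fun q => h'' ((pag_adj hP hM _ _).2 q))).1 ⟨g4, g5⟩).1
      rw [Arr, h] at hu; simp at hu
  have hcc : ∀ i, ColliderAt P p i → ColliderAt M p i := by
    rintro i ⟨a, b, e, h1, h2, h3, h4, h5⟩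
    exact ⟨a, b, e, h1, h2, h3, pag_arr hP hM h4, pag_arr hP hM h5⟩
  have hexcl : ∀ i, DefNonColliderAt M p i → ¬ ColliderAt M p i := by
    rintro i ⟨a, b, e, h1, h2, h3, h4⟩ ⟨a', b', e', g1, g2, g3, g4, g5⟩
    rw [h1] at g1; rw [h2] at g2; rw [h3] at g3
    simp only [Option.some.injEq] at g1 g2 g3
    subst g1; subst g2; subst g3
    rw [g4, g5] at h4; simp at h4
  have hlen : ∀ i, (ColliderAt M p i ∨ DefNonColliderAt M p i) → i + 2 < p.length := by
    rintro i (⟨a, b, e, h1, h2, h3, h4⟩ | ⟨a, b, e, h1, h2, h3, h4⟩) <;>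
      exact (List.getElem?_eq_some_iff.1 h3).1
  refine ⟨⟨⟨hne, hnd, chain_of_succ hsM⟩, hh, hl, hpx⟩, ?_, ?_, ?_, ?_⟩
  · intro h
    exact hpd fun i a b h1 h2 h3 => h i a b h1 h2 (pag_arr hP hM h3)
  · intro i hi
    by_cases hcm : ColliderAt M p i
    · exact Or.inl hcm
    right
    have g1 : p[i]? = some p[i] := by simp
    have g2 : p[i+1]? = some p[i+1] := by simp
    have g3 : p[i+2]? = some p[i+2] := by simp
    refine ⟨_, _, _, g1, g2, g3, ?_⟩
    by_cases q : M.Arr p[i] p[i+1]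
    · right; left
      refine (dir_of_narr ha.1 (adj_symm (hsM (i+1) _ _ g2 g3)) fun q2 => ?_).2
      exact hcm ⟨_, _, _, g1, g2, g3, q, q2⟩
    · left
      exact (dir_of_narr ha.1 (hsM i _ _ g1 g2) q).2
  · intro i b hb hn
    rcases hds i (hlen i (Or.inr hn)) with h | h
    · exact absurd (hcc i h) (hexcl i hn)
    · exact hc.2.1 i b hb h
  · intro i b hb hn
    rcases hds i (hlen i (Or.inl hn)) with h | h
    · obtain ⟨z, hz, hz2⟩ := hc.2.2 i b hb h
      exact ⟨z, hz, desc_iff.2 (Relation.ReflTransGen.mono (fun _ _ h => pag_dir hP hM h) _ _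
        (desc_iff.1 hz2))⟩
    · exact absurd hn (hnc i h)

end PMG

open PMG in
/-- For an amenable PAG with `Z ∩ Forb(X,Y,P) = ∅`: condition (2) of the GAC is
equivalent to condition (b) of the AC holding in every MAG of the equivalence class. -/
theorem gac2_iff_ac_b_pag {V : Type} [Fintype V] [DecidableEq V]
    (P : PMG V) (cls : Set (PMG V)) (hP : IsPAGOf P cls) (X Y Z : Finset V)
    (hXY : Disjoint X Y) (hX : X.Nonempty) (hY : Y.Nonempty)
    (hZdisj : Disjoint Z (X ∪ Y))
    (hAm : Amenable P (Visible P) X Y)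
    (hZforb : ∀ z ∈ Z, z ∉ Forb P X Y) :
    (∀ p, ProperPath P X Y p → DefStatus P p → ¬ PossDirAlong P p → ¬ MConn P Z p) ↔
      (∀ M ∈ cls, ∀ p, ProperPath M X Y p → ¬ PossDirAlong M p → ¬ MConn M Z p) := by
  constructor
  · intro h M hM p hp hpd hc
    have s : Setup P cls X Y Z := ⟨hP, hXY, by convert hZdisj, hAm, hZforb⟩
    obtain ⟨w, n, hw⟩ := exists_gw s hM hp hpd hc
    obtain ⟨w', n', hw'⟩ := exists_core2 s hM hw
    obtain ⟨q, h1, h2, h3, h4⟩ := hw'.final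
    exact h q h1 h2 h3 h4
  · intro h p hp hds hpd hc
    obtain ⟨M, hM⟩ := hP.1
    obtain ⟨h1, h2, h3⟩ := back hP hM hp hds hpd hc
    exact h M hM p h1 h2 h3
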